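/- Let d ∈ ℕ, m > 1, and let M be a d×d-matrix-valued function on ℝ^d whose entries are restrictions to ℝ^d of entire functions on ℂ^d. Then there exists an entire function φ_m : ℂ → ℂ, real-valued and monotonically increasing on [0,∞) with φ_m(0) = 0, such that the following holds: for all σ₀ > 0, η > 0 and T* > 0 with σ₀ - ηT* ≥ 0, and every ℝ^d-valued solution u ∈ C¹([0,T*], G^{m+2}_{σ₀}) of ∂_T u = M(u) ∂_X u, the function T ↦ ‖u(T)‖²_{G^m_{σ(T)}}, where σ(T) = σ₀ - ηT, is differentiable on (0,T*] and satisfies (1/2) d/dT ‖u(T)‖²_{G^m_{σ(T)}} + ( η - ‖M(0)‖ - φ_m(‖u(T)‖_{G^m_{σ(T)}}) ) ‖u(T)‖²_{G^{m+1/2}_{σ(T)}} ≤ 0 for all T ∈ (0,T*], where ‖M(0)‖ denotes the operator norm of the constant matrix M(0). -/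

import Mathlib

open MeasureTheory

noncomputable def fHat {E : Type*} [NormedAddCommGroup E] [NormedSpace ℂ E]
    (u : ℝ → E) (k : ℝ) : E :=
  (Real.sqrt (2 * Real.pi))⁻¹ • ∫ x : ℝ, Complex.exp (-(Complex.I * k * x)) • u x

noncomputable def gevreyWeight (m σ k : ℝ) : ℝ :=
  Real.exp (2 * σ * (1 + |k|)) * (1 + k ^ 2) ^ m

def MemGevrey {E : Type*} [NormedAddCommGroup E] [NormedSpace ℂ E]
    (m σ : ℝ) (u : ℝ → E) : Prop :=
  Integrable u ∧ Integrable (fun k => gevreyWeight m σ k * ‖fHat u k‖ ^ 2)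

noncomputable def gevreyNorm {E : Type*} [NormedAddCommGroup E] [NormedSpace ℂ E]
    (m σ : ℝ) (u : ℝ → E) : ℝ :=
  Real.sqrt (∫ k : ℝ, gevreyWeight m σ k * ‖fHat u k‖ ^ 2)

def GevreyContOn {E : Type*} [NormedAddCommGroup E] [NormedSpace ℂ E]
    (m σ : ℝ) (u : ℝ → ℝ → E) (s : Set ℝ) : Prop :=
  (∀ t ∈ s, MemGevrey m σ (u t)) ∧
  ∀ t ∈ s, Filter.Tendsto (fun t' => gevreyNorm m σ (fun x => u t' x - u t x))
      (nhdsWithin t s) (nhds 0)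

def GevreyC1On {E : Type*} [NormedAddCommGroup E] [NormedSpace ℂ E]
    (m σ : ℝ) (u : ℝ → ℝ → E) (s : Set ℝ) : Prop :=
  ∃ v : ℝ → ℝ → E,
    (∀ t ∈ s, Filter.Tendsto
      (fun t' => gevreyNorm m σ (fun x => (t' - t)⁻¹ • (u t' x - u t x) - v t x))
      (nhdsWithin t (s \ {t})) (nhds 0)) ∧
    GevreyContOn m σ v s

/-- View an `ℂ^d`-valued function as a function with values in `EuclideanSpace ℂ (Fin d)`. -/
noncomputable def vecE {d : ℕ} (w : ℝ → Fin d → ℂ) : ℝ → EuclideanSpace ℂ (Fin d) :=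
  fun X => (WithLp.equiv 2 (Fin d → ℂ)).symm (w X)

/-- The operator norm of a real `d × d` matrix, acting on Euclidean space. -/
noncomputable def matOpNorm {d : ℕ} (A : Matrix (Fin d) (Fin d) ℝ) : ℝ :=
  ‖LinearMap.toContinuousLinearMap (Matrix.toEuclideanLin A)‖

theorem hasSum_congr {ι E : Type*} [AddCommMonoid E] [TopologicalSpace E] {f g : ι → E} {a : E}
    (h : ∀ i, f i = g i) : HasSum f a ↔ HasSum g a := by
  rw [funext h]

theorem summable_prod_pow_multiindex {q : ℝ} (hq0 : 0 ≤ q) (hq1 : q < 1) (d : ℕ) :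
    Summable (fun α : Fin d → ℕ => ∏ i, q ^ α i) := by
  induction d with
  | zero => exact (hasSum_fintype _).summable
  | succ d ih =>
    rw [← (Fin.consEquiv (fun _ : Fin (d + 1) => ℕ)).summable_iff]
    have := (summable_geometric_of_lt_one hq0 hq1).mul_of_nonneg ih
      (fun n => by positivity) (fun α => by positivity)
    refine this.congr fun p => ?_
    simp [Fin.prod_univ_succ, Fin.consEquiv]

theorem iteratedDeriv_cons_eq {d : ℕ} {f : (Fin (d + 1) → ℂ) → ℂ}
    (hf : ∀ z, AnalyticAt ℂ f z) (n : ℕ) :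
    ∃ g : (Fin (d + 1) → ℂ) → ℂ, (∀ z, AnalyticAt ℂ g z) ∧
      ∀ w : Fin d → ℂ, ∀ t : ℂ,
        iteratedDeriv n (fun s => f (Fin.cons s w)) t = g (Fin.cons t w) := by
  induction n with
  | zero => exact ⟨f, hf, fun w t => by simp⟩
  | succ n ih =>
    obtain ⟨g, hg, h⟩ := ih
    refine ⟨fun z => fderiv ℂ g z (Pi.single 0 1), fun z => ?_, fun w t => ?_⟩
    · exact ((ContinuousLinearMap.apply ℂ ℂ (Pi.single (0 : Fin (d + 1)) (1 : ℂ))).analyticAt _).comp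
        (hg z).fderiv
    · rw [iteratedDeriv_succ]
      have : iteratedDeriv n (fun s => f (Fin.cons s w)) = fun t => g (Fin.cons t w) :=
        funext (h w)
      rw [this]
      refine HasDerivAt.deriv ?_
      refine (hg _).differentiableAt.hasFDerivAt.comp_hasDerivAt t ?_
      rw [hasDerivAt_pi]
      intro i
      refine Fin.cases ?_ (fun j => ?_) i
      · exact hasDerivAt_id' t
      · exact hasDerivAt_const t (w j)

theorem analyticAt_cons_right {d : ℕ} {g : (Fin (d + 1) → ℂ) → ℂ}
    (hg : ∀ z, AnalyticAt ℂ g z) (t : ℂ) (w : Fin d → ℂ) :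
    AnalyticAt ℂ (fun w : Fin d → ℂ => g (Fin.cons t w)) w := by
  refine (hg _).comp (f := fun w : Fin d → ℂ => (Fin.cons t w : Fin (d + 1) → ℂ)) ?_
  rw [analyticAt_pi_iff]
  intro i
  refine Fin.cases ?_ (fun j => ?_) i
  · exact analyticAt_const
  · exact (ContinuousLinearMap.proj (R := ℂ) (φ := fun _ : Fin d => ℂ) j).analyticAt w

/-- The multi-index power series of an entire function of several complex variables, with the
Cauchy estimates for its coefficients. -/
theorem exists_multiindex_powerSeries (d : ℕ) (f : (Fin d → ℂ) → ℂ)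
    (hf : ∀ z, AnalyticAt ℂ f z) :
    ∃ c : (Fin d → ℕ) → ℂ,
      (∀ R : ℝ, 0 < R → ∀ B : ℝ, (∀ z, (∀ i, ‖z i‖ ≤ R) → ‖f z‖ ≤ B) →
        ∀ α, ‖c α‖ ≤ B * ∏ i, (R ^ α i)⁻¹) ∧
      ∀ z, HasSum (fun α => c α * ∏ i, z i ^ α i) (f z) := by
  induction d with
  | zero =>
    refine ⟨fun _ => f 0, fun R _ B hB α => ?_, fun z => ?_⟩
    · simpa only [Finset.univ_eq_empty, Finset.prod_empty, mul_one] using hB 0 (fun i => i.elim0)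
    · have : z = 0 := Subsingleton.elim _ _
      subst this
      simp
  | succ d ih =>
    choose g hga hg using iteratedDeriv_cons_eq hf
    have hgn : ∀ n : ℕ, ∀ w, AnalyticAt ℂ
        (fun w : Fin d → ℂ => ((n.factorial : ℂ)⁻¹) * g n (Fin.cons 0 w)) w :=
      fun n w => analyticAt_const.mul (analyticAt_cons_right (hga n) 0 w)
    choose c hcB hcS using fun n => ih _ (hgn n)
    have hdiff : ∀ w : Fin d → ℂ, Differentiable ℂ (fun s => f (Fin.cons s w)) := by
      intro w s
      refine DifferentiableAt.comp (f := fun s : ℂ => (Fin.cons s w : Fin (d + 1) → ℂ)) s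
        (hf _).differentiableAt ?_
      rw [differentiableAt_pi]
      intro i
      refine Fin.cases ?_ (fun j => ?_) i
      · simp
      · simp
    have hbound : ∀ R : ℝ, 0 < R → ∀ B : ℝ, (∀ z, (∀ i, ‖z i‖ ≤ R) → ‖f z‖ ≤ B) →
        ∀ α : Fin (d + 1) → ℕ, ‖c (α 0) (Fin.tail α)‖ ≤ B * ∏ i, (R ^ α i)⁻¹ := by
      intro R hR B hB α
      have := hcB (α 0) R hR (B * (R ^ α 0)⁻¹) (fun w hw => ?_) (Fin.tail α)
      · rw [Fin.prod_univ_succ, ← mul_assoc]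
        exact this
      · rw [← hg, norm_mul, norm_inv, Complex.norm_natCast]
        have h1 := Complex.norm_iteratedDeriv_le_of_forall_mem_sphere_norm_le (α 0) hR
          (hdiff w).diffContOnCl (C := B) (c := 0) (fun s hs => hB _ fun i => ?_)
        · rw [inv_mul_le_iff₀ (by positivity)]
          refine h1.trans (le_of_eq ?_)
          field_simp
        · refine Fin.cases ?_ (fun j => ?_) i
          · simpa using (mem_sphere_zero_iff_norm.1 hs).le
          · simpa using hw j
    refine ⟨fun α => c (α 0) (Fin.tail α), hbound, fun z => ?_⟩
    obtain ⟨B, hB⟩ : ∃ B, ∀ w : Fin (d + 1) → ℂ, (∀ i, ‖w i‖ ≤ 2 * (‖z‖ + 1)) → ‖f w‖ ≤ B := by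
      have hc : Continuous f := continuous_iff_continuousAt.2 fun w => (hf w).continuousAt
      obtain ⟨B, hB⟩ := (isCompact_closedBall (0 : Fin (d + 1) → ℂ)
        (2 * (‖z‖ + 1))).exists_bound_of_continuousOn hc.continuousOn
      refine ⟨B, fun w hw => hB w ?_⟩
      rw [mem_closedBall_zero_iff]
      exact (pi_norm_le_iff_of_nonneg (by positivity)).2 hw
    have hsum : Summable (fun α : Fin (d + 1) → ℕ => c (α 0) (Fin.tail α) * ∏ i, z i ^ α i) := by
      refine Summable.of_norm_bounded
        ((summable_prod_pow_multiindex (q := 1 / 2) (by norm_num) (by norm_num) (d + 1)).mul_left B)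
        (fun α => ?_)
      have hB0 : 0 ≤ B := (norm_nonneg _).trans (hB 0 fun i => by simp; positivity)
      rw [norm_mul, norm_prod]
      refine (mul_le_mul_of_nonneg_right (hbound _ (by positivity) B hB α)
        (by positivity)).trans ?_
      rw [mul_assoc, ← Finset.prod_mul_distrib]
      refine mul_le_mul_of_nonneg_left (Finset.prod_le_prod (fun i _ => by positivity)
        fun i _ => ?_) hB0
      rw [norm_pow, ← inv_pow, ← mul_pow]
      refine pow_le_pow_left₀ (by positivity) ?_ _
      rw [inv_mul_le_iff₀ (by positivity)]
      have := norm_le_pi_norm z i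
      linarith
    have h2 := (Fin.consEquiv (fun _ : Fin (d + 1) => ℕ)).hasSum_iff.2 hsum.hasSum
    have h3 := h2.prod_fiberwise (g := fun n => z 0 ^ n *
      ((n.factorial : ℂ)⁻¹ * g n (Fin.cons 0 (Fin.tail z)))) (fun n => by
        refine (hasSum_congr ?_).1 ((hcS n (Fin.tail z)).mul_left (z 0 ^ n))
        intro α
        simp only [Function.comp, Fin.consEquiv, Equiv.coe_fn_mk, Fin.prod_univ_succ,
          Fin.cons_zero, Fin.cons_succ, Fin.tail_cons, Fin.tail]
        ring)
    have h4 := Complex.hasSum_taylorSeries_of_entire (hdiff (Fin.tail z)) 0 (z 0)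
    have h5 : f z = ∑' α : Fin (d + 1) → ℕ, c (α 0) (Fin.tail α) * ∏ i, z i ^ α i := by
      have h6 : f (Fin.cons (z 0) (Fin.tail z)) = f z := by rw [Fin.cons_self_tail]
      rw [← h6]
      refine h4.unique ?_
      refine (hasSum_congr ?_).1 h3
      intro n
      rw [hg, sub_zero, smul_eq_mul, smul_eq_mul]
      ring
    rw [h5]
    exact hsum.hasSum

theorem exists_summable_multiindex_powerSeries (d : ℕ) (f : (Fin d → ℂ) → ℂ)
    (hf : ∀ z, AnalyticAt ℂ f z) :
    ∃ c : (Fin d → ℕ) → ℂ,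
      (∀ r : ℝ, 0 ≤ r → Summable (fun α => ‖c α‖ * r ^ (∑ i, α i))) ∧
      ∀ z, HasSum (fun α => c α * ∏ i, z i ^ α i) (f z) := by
  obtain ⟨c, hc, hs⟩ := exists_multiindex_powerSeries d f hf
  refine ⟨c, fun r hr => ?_, hs⟩
  refine (hs (fun _ => (r : ℂ))).summable.norm.congr fun α => ?_
  rw [norm_mul, norm_prod, ← Finset.prod_pow_eq_pow_sum]
  simp [abs_of_nonneg hr]

/-- A power series with nonnegative coefficients and infinite radius of convergence that has no
constant term. -/
theorem exists_entire_of_summable {ι : Type*} (b : ι → ℝ) (n : ι → ℕ) (hb : ∀ i, 0 ≤ b i)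
    (hn : ∀ i, n i = 0 → b i = 0)
    (hs : ∀ r : ℝ, 0 ≤ r → Summable (fun i => b i * r ^ n i)) :
    ∃ φ : ℂ → ℂ, (∀ z, AnalyticAt ℂ φ z) ∧ φ 0 = 0 ∧
      MonotoneOn (fun x : ℝ => (φ x).re) (Set.Ici 0) ∧
      ∀ x : ℝ, φ x = ((∑' i, b i * x ^ n i : ℝ) : ℂ) := by
  have hreal : ∀ x : ℝ, (∑' i, (b i : ℂ) * (x : ℂ) ^ n i) = ((∑' i, b i * x ^ n i : ℝ) : ℂ) := by
    intro x
    rw [Complex.ofReal_tsum]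
    simp
  refine ⟨fun z => ∑' i, (b i : ℂ) * z ^ n i, fun z => ?_, ?_, ?_, hreal⟩
  · have hd : DifferentiableOn ℂ (fun z => ∑' i, (b i : ℂ) * z ^ n i)
        (Metric.ball 0 (‖z‖ + 1)) := by
      refine Complex.differentiableOn_tsum_of_summable_norm (hs (‖z‖ + 1) (by positivity))
        (fun i => ?_) Metric.isOpen_ball (fun i w hw => ?_)
      · exact (differentiable_const _ |>.mul (differentiable_id.pow _)).differentiableOn
      · rw [norm_mul, norm_pow, Complex.norm_real, Real.norm_of_nonneg (hb i)]
        have : ‖w‖ ≤ ‖z‖ + 1 := (mem_ball_zero_iff.1 hw).le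
        gcongr
        exact hb i
    exact hd.analyticAt (Metric.isOpen_ball.mem_nhds (by simp))
  · have : ∀ i, (b i : ℂ) * 0 ^ n i = 0 := fun i => by
      by_cases h : n i = 0
      · simp [hn i h]
      · simp [h]
    simp [this]
  · intro x hx y hy hxy
    simp only [hreal, Complex.ofReal_re]
    refine (hs x hx).tsum_le_tsum (fun i => ?_) (hs y hy)
    have h0 : (0 : ℝ) ≤ x := hx
    have := hb i
    gcongr

theorem gevreyWeight_pos (s σ k : ℝ) : 0 < gevreyWeight s σ k := by
  unfold gevreyWeight; positivity

/-- The square root of `gevreyWeight`. -/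
noncomputable def sqrtWeight (s σ k : ℝ) : ℝ :=
  Real.exp (σ * (1 + |k|)) * (1 + k ^ 2) ^ (s / 2)

theorem sqrtWeight_pos (s σ k : ℝ) : 0 < sqrtWeight s σ k := by
  unfold sqrtWeight; positivity

theorem sqrtWeight_sq (s σ k : ℝ) : sqrtWeight s σ k ^ 2 = gevreyWeight s σ k := by
  unfold sqrtWeight gevreyWeight
  rw [mul_pow, ← Real.exp_nat_mul, ← Real.rpow_mul_natCast (by positivity)]
  congr 2
  · push_cast; ring
  · push_cast; ring

theorem continuous_sqrtWeight (s σ : ℝ) : Continuous (sqrtWeight s σ) := by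
  unfold sqrtWeight
  refine Continuous.mul (by fun_prop) (Continuous.rpow_const (by fun_prop) fun k => ?_)
  left; positivity

theorem continuous_gevreyWeight (s σ : ℝ) : Continuous (gevreyWeight s σ) := by
  simp_rw [← funext (sqrtWeight_sq s σ)]
  exact (continuous_sqrtWeight s σ).pow 2

theorem one_add_sq_rpow_le {s : ℝ} (hs : 0 ≤ s) (k l : ℝ) :
    (1 + k ^ 2) ^ s ≤ 4 ^ s * ((1 + l ^ 2) ^ s + (1 + (k - l) ^ 2) ^ s) := by
  have h1 : 1 + k ^ 2 ≤ 4 * max (1 + l ^ 2) (1 + (k - l) ^ 2) := by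
    have := le_max_left (1 + l ^ 2) (1 + (k - l) ^ 2)
    have := le_max_right (1 + l ^ 2) (1 + (k - l) ^ 2)
    nlinarith [sq_nonneg (l - (k - l))]
  refine (Real.rpow_le_rpow (by positivity) h1 hs).trans ?_
  rw [Real.mul_rpow (by norm_num) (by positivity)]
  refine mul_le_mul_of_nonneg_left ?_ (by positivity)
  rcases max_cases (1 + l ^ 2) (1 + (k - l) ^ 2) with ⟨h, _⟩ | ⟨h, _⟩ <;> rw [h]
  · have : 0 ≤ (1 + (k - l) ^ 2) ^ s := by positivity
    linarith
  · have : 0 ≤ (1 + l ^ 2) ^ s := by positivity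
    linarith

theorem gevreyWeight_le_mul {s σ : ℝ} (hs : 0 ≤ s) (hσ : 0 ≤ σ) (k l : ℝ) :
    gevreyWeight s σ k ≤ gevreyWeight s σ l * gevreyWeight s σ (k - l) *
      (4 ^ s * ((1 + l ^ 2) ^ (-s) + (1 + (k - l) ^ 2) ^ (-s))) := by
  unfold gevreyWeight
  have hexp : Real.exp (2 * σ * (1 + |k|)) ≤
      Real.exp (2 * σ * (1 + |l|)) * Real.exp (2 * σ * (1 + |k - l|)) := by
    rw [← Real.exp_add, Real.exp_le_exp]
    have : |k| ≤ |l| + |k - l| := by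
      have := abs_add_le l (k - l); simpa using this
    nlinarith
  have hl : 0 < (1 + l ^ 2) ^ s := by positivity
  have hkl : 0 < (1 + (k - l) ^ 2) ^ s := by positivity
  rw [Real.rpow_neg (by positivity), Real.rpow_neg (by positivity)]
  refine (mul_le_mul hexp (one_add_sq_rpow_le hs k l) (by positivity) (by positivity)).trans
    (le_of_eq ?_)
  field_simp
  ring

theorem integrable_one_add_sq_rpow_neg {s : ℝ} (hs : 1 / 2 < s) :
    Integrable (fun k : ℝ => (1 + k ^ 2) ^ (-s)) := by
  have := integrable_rpow_neg_one_add_norm_sq (E := ℝ) (μ := volume) (r := 2 * s)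
    (by simp; linarith)
  refine this.congr (Filter.Eventually.of_forall fun k => ?_)
  simp only [Real.norm_eq_abs, sq_abs]
  congr 1; ring

theorem exists_convolution_bound {s : ℝ} (hs : 1 / 2 < s) :
    ∃ K : ℝ, 0 ≤ K ∧ ∀ σ : ℝ, 0 ≤ σ → ∀ F G : ℝ → ENNReal, Measurable F → Measurable G →
      ∫⁻ k, ENNReal.ofReal (gevreyWeight s σ k) * (∫⁻ l, F l * G (k - l)) ^ 2 ≤
        ENNReal.ofReal K * (∫⁻ k, ENNReal.ofReal (gevreyWeight s σ k) * F k ^ 2) *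
          ∫⁻ k, ENNReal.ofReal (gevreyWeight s σ k) * G k ^ 2 := by
  set J : ℝ := ∫ k : ℝ, (1 + k ^ 2) ^ (-s) with hJ
  have hJ0 : 0 ≤ J := integral_nonneg fun k => by positivity
  refine ⟨4 ^ s * (J + J), by positivity, fun σ hσ F G hF hG => ?_⟩
  set W : ℝ → ENNReal := fun k => ENNReal.ofReal (gevreyWeight s σ k) with hW
  have hWm : Measurable W := (continuous_gevreyWeight s σ).measurable.ennreal_ofReal
  have hW0 : ∀ k, W k ≠ 0 := fun k => by simpa [hW] using gevreyWeight_pos s σ k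
  have hWt : ∀ k, W k ≠ ⊤ := fun k => ENNReal.ofReal_ne_top
  set R : ℝ → ℝ → ENNReal := fun k l =>
    ENNReal.ofReal (sqrtWeight s σ l * sqrtWeight s σ (k - l)) with hR
  have hR0 : ∀ k l, R k l ≠ 0 := fun k l => by
    simpa [hR] using mul_pos (sqrtWeight_pos s σ l) (sqrtWeight_pos s σ (k - l))
  have hRt : ∀ k l, R k l ≠ ⊤ := fun k l => ENNReal.ofReal_ne_top
  have hR2 : ∀ k l, R k l ^ 2 = W l * W (k - l) := fun k l => by
    rw [hR, hW, ← ENNReal.ofReal_pow (by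
      have := sqrtWeight_pos s σ l; have := sqrtWeight_pos s σ (k - l); positivity), mul_pow,
      sqrtWeight_sq, sqrtWeight_sq, ENNReal.ofReal_mul (gevreyWeight_pos s σ l).le]
  have hRm : ∀ k, Measurable (R k) := fun k =>
    (((continuous_sqrtWeight s σ).mul ((continuous_sqrtWeight s σ).comp
      (continuous_const.sub continuous_id))).measurable).ennreal_ofReal
  have hGk : ∀ k, Measurable fun l => G (k - l) := fun k =>
    hG.comp (measurable_const.sub measurable_id)
  have hkernel : ∀ k, W k * ∫⁻ l, (R k l)⁻¹ ^ 2 ≤ ENNReal.ofReal (4 ^ s * (J + J)) := by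
    intro k
    have hint := integrable_one_add_sq_rpow_neg hs
    have hint' : Integrable (fun l : ℝ => (1 + (k - l) ^ 2) ^ (-s)) := hint.comp_sub_left k
    have hE : ENNReal.ofReal (4 ^ s * (J + J)) = ∫⁻ l : ℝ, ENNReal.ofReal
        (4 ^ s * ((1 + l ^ 2) ^ (-s) + (1 + (k - l) ^ 2) ^ (-s))) := by
      have hadd : Integrable (fun l : ℝ =>
          4 ^ s * ((1 + l ^ 2) ^ (-s) + (1 + (k - l) ^ 2) ^ (-s))) := (hint.add hint').const_mul _
      rw [← ofReal_integral_eq_lintegral_ofReal hadd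
        (Filter.Eventually.of_forall fun l => by positivity)]
      rw [integral_const_mul, integral_add hint hint',
        integral_sub_left_eq_self (fun l : ℝ => (1 + l ^ 2) ^ (-s)) volume k]
    have hRi : Measurable fun l => (R k l)⁻¹ ^ 2 := (hRm k).inv.pow_const 2
    rw [hE, ← lintegral_const_mul _ hRi]
    refine lintegral_mono fun l => ?_
    rw [← ENNReal.inv_pow, hR2, ← div_eq_mul_inv]
    refine ENNReal.div_le_of_le_mul ?_
    rw [hW, ← ENNReal.ofReal_mul (gevreyWeight_pos s σ l).le, ← ENNReal.ofReal_mul (by positivity)]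
    refine ENNReal.ofReal_le_ofReal ((gevreyWeight_le_mul (by linarith) hσ k l).trans
      (le_of_eq (mul_comm _ _)))
  have hpt : ∀ k, W k * (∫⁻ l, F l * G (k - l)) ^ 2 ≤ ENNReal.ofReal (4 ^ s * (J + J)) *
      ∫⁻ l, (W l * F l ^ 2) * (W (k - l) * G (k - l) ^ 2) := by
    intro k
    have hcs := ENNReal.lintegral_mul_le_Lp_mul_Lq volume Real.HolderConjugate.two_two
      (f := fun l => (R k l)⁻¹) (g := fun l => R k l * (F l * G (k - l)))
      (hRm k).inv.aemeasurable ((hRm k).mul (hF.mul (hGk k))).aemeasurable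
    have h1 : ∀ l, ((fun l => (R k l)⁻¹) * fun l => R k l * (F l * G (k - l))) l =
        F l * G (k - l) := fun l => by
      simp only [Pi.mul_apply]
      rw [← mul_assoc, ENNReal.inv_mul_cancel (hR0 k l) (hRt k l), one_mul]
    rw [lintegral_congr h1] at hcs
    have hcs2 : (∫⁻ l, F l * G (k - l)) ^ 2 ≤ (∫⁻ l, (R k l)⁻¹ ^ 2) *
        ∫⁻ l, (R k l * (F l * G (k - l))) ^ 2 := by
      refine (pow_le_pow_left' hcs 2).trans (le_of_eq ?_)
      rw [mul_pow, ← ENNReal.rpow_mul_natCast, ← ENNReal.rpow_mul_natCast]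
      norm_num
    have h2 : ∫⁻ l, (R k l * (F l * G (k - l))) ^ 2 =
        ∫⁻ l, (W l * F l ^ 2) * (W (k - l) * G (k - l) ^ 2) := by
      refine lintegral_congr fun l => ?_
      rw [mul_pow, hR2]; ring
    rw [h2] at hcs2
    calc W k * (∫⁻ l, F l * G (k - l)) ^ 2 ≤ W k * ((∫⁻ l, (R k l)⁻¹ ^ 2) *
          ∫⁻ l, (W l * F l ^ 2) * (W (k - l) * G (k - l) ^ 2)) := by gcongr
      _ = (W k * (∫⁻ l, (R k l)⁻¹ ^ 2)) *
          ∫⁻ l, (W l * F l ^ 2) * (W (k - l) * G (k - l) ^ 2) := by rw [mul_assoc]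
      _ ≤ _ := by gcongr; exact hkernel k
  have hWF : Measurable fun k => W k * F k ^ 2 := hWm.mul (hF.pow_const 2)
  have hWG : Measurable fun k => W k * G k ^ 2 := hWm.mul (hG.pow_const 2)
  have hjoint : Measurable (Function.uncurry fun k l : ℝ =>
      (W l * F l ^ 2) * (W (k - l) * G (k - l) ^ 2)) :=
    (hWF.comp measurable_snd).mul (hWG.comp (measurable_fst.sub measurable_snd))
  refine (lintegral_mono hpt).trans (le_of_eq ?_)
  rw [lintegral_const_mul' _ _ ENNReal.ofReal_ne_top, lintegral_lintegral_swap hjoint.aemeasurable,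
    mul_assoc]
  congr 1
  rw [← lintegral_mul_const _ hWF]
  refine lintegral_congr fun l => ?_
  have hWGl : Measurable fun k => W (k - l) * G (k - l) ^ 2 :=
    hWG.comp (measurable_id.sub measurable_const)
  rw [lintegral_const_mul _ hWGl, lintegral_sub_right_eq_self (fun k => W k * G k ^ 2) l]

/-- The inverse of `fHat` for scalar functions. -/
noncomputable def fourierSynth (h : ℝ → ℂ) (x : ℝ) : ℂ :=
  ((Real.sqrt (2 * Real.pi))⁻¹ : ℝ) * ∫ k : ℝ, Complex.exp (Complex.I * k * x) * h k

theorem norm_cexp_I_mul (k x : ℝ) : ‖Complex.exp (Complex.I * k * x)‖ = 1 := by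
  rw [mul_assoc, ← Complex.ofReal_mul, mul_comm, Complex.norm_exp_ofReal_mul_I]

theorem inv_sqrt_two_pi_pos : 0 < (Real.sqrt (2 * Real.pi))⁻¹ := by positivity

theorem inv_sqrt_two_pi_le_one : (Real.sqrt (2 * Real.pi))⁻¹ ≤ 1 := by
  apply inv_le_one_of_one_le₀
  rw [Real.one_le_sqrt]
  linarith [Real.pi_gt_three]

theorem integrable_cexp_mul {h : ℝ → ℂ} (hh : Integrable h) (x : ℝ) :
    Integrable (fun k : ℝ => Complex.exp (Complex.I * k * x) * h k) := by
  refine hh.bdd_mul (c := 1) (Continuous.aestronglyMeasurable (by fun_prop)) ?_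
  exact Filter.Eventually.of_forall fun k => (norm_cexp_I_mul k x).le

theorem fourierSynth_congr {h h' : ℝ → ℂ} (hh : h =ᵐ[volume] h') :
    fourierSynth h = fourierSynth h' := by
  funext x
  unfold fourierSynth
  congr 1
  exact integral_congr_ae (hh.mono fun k hk => by simp only [hk])

theorem norm_fourierSynth_le (h : ℝ → ℂ) (x : ℝ) : ‖fourierSynth h x‖ ≤ ∫ k, ‖h k‖ := by
  unfold fourierSynth
  rw [norm_mul, Complex.norm_real, Real.norm_of_nonneg inv_sqrt_two_pi_pos.le]
  calc _ ≤ 1 * ‖∫ k : ℝ, Complex.exp (Complex.I * k * x) * h k‖ := by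
        gcongr; exact inv_sqrt_two_pi_le_one
    _ ≤ ∫ k : ℝ, ‖Complex.exp (Complex.I * k * x) * h k‖ := by
        rw [one_mul]; exact norm_integral_le_integral_norm _
    _ = _ := by simp_rw [norm_mul, norm_cexp_I_mul, one_mul]

/-- `h` lies in the weighted `L²` space with weight `gevreyWeight s σ`, with norm at most `B`. -/
def GevreyBound (s σ : ℝ) (h : ℝ → ℂ) (B : ℝ) : Prop :=
  MemLp (fun k => (sqrtWeight s σ k : ℂ) * h k) 2 ∧
    eLpNorm (fun k => (sqrtWeight s σ k : ℂ) * h k) 2 volume ≤ ENNReal.ofReal B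

theorem GevreyBound.congr {s σ : ℝ} {h h' : ℝ → ℂ} {B : ℝ} (hh : GevreyBound s σ h B)
    (e : h =ᵐ[volume] h') : GevreyBound s σ h' B := by
  have e' : (fun k => (sqrtWeight s σ k : ℂ) * h k) =ᵐ[volume]
      (fun k => (sqrtWeight s σ k : ℂ) * h' k) := e.mono fun k hk => by simp only [hk]
  exact ⟨(memLp_congr_ae e').1 hh.1, (eLpNorm_congr_ae e') ▸ hh.2⟩

theorem aestronglyMeasurable_of_sqrtWeight_mul {s σ : ℝ} {h : ℝ → ℂ}
    (hh : AEStronglyMeasurable (fun k => (sqrtWeight s σ k : ℂ) * h k) volume) :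
    AEStronglyMeasurable h volume := by
  have h1 : AEStronglyMeasurable (fun k => ((sqrtWeight s σ k)⁻¹ : ℂ)) volume := by
    refine Continuous.aestronglyMeasurable (Continuous.inv₀ ?_ fun k => ?_)
    · exact Complex.continuous_ofReal.comp (continuous_sqrtWeight s σ)
    · exact_mod_cast (sqrtWeight_pos s σ k).ne'
  refine (h1.mul hh).congr (Filter.Eventually.of_forall fun k => ?_)
  have : (sqrtWeight s σ k : ℂ) ≠ 0 := by exact_mod_cast (sqrtWeight_pos s σ k).ne'
  simp only [Pi.mul_apply]
  field_simp

theorem memLp_inv_sqrtWeight {s σ : ℝ} (hs : 1 / 2 < s) (hσ : 0 ≤ σ) :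
    MemLp (fun k => ((sqrtWeight s σ k)⁻¹ : ℂ)) 2 volume := by
  have hc : Continuous (fun k => ((sqrtWeight s σ k)⁻¹ : ℂ)) := by
    refine Continuous.inv₀ (Complex.continuous_ofReal.comp (continuous_sqrtWeight s σ)) fun k => ?_
    exact_mod_cast (sqrtWeight_pos s σ k).ne'
  rw [memLp_two_iff_integrable_sq_norm hc.aestronglyMeasurable]
  refine (integrable_one_add_sq_rpow_neg hs).mono' (hc.norm.pow 2).aestronglyMeasurable
    (Filter.Eventually.of_forall fun k => ?_)
  rw [norm_pow, norm_norm, norm_inv, Complex.norm_real, Real.norm_of_nonneg (sqrtWeight_pos s σ k).le,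
    inv_pow, sqrtWeight_sq, gevreyWeight, Real.rpow_neg (by positivity)]
  apply inv_anti₀ (by positivity)
  refine le_mul_of_one_le_left (by positivity) (Real.one_le_exp (by positivity))

theorem integrable_of_memLp_sqrtWeight_mul {s σ : ℝ} {h : ℝ → ℂ} (hs : 1 / 2 < s) (hσ : 0 ≤ σ)
    (hh : MemLp (fun k => (sqrtWeight s σ k : ℂ) * h k) 2) : Integrable h := by
  refine ((memLp_inv_sqrtWeight hs hσ).integrable_mul hh).congr
    (Filter.Eventually.of_forall fun k => ?_)
  have : (sqrtWeight s σ k : ℂ) ≠ 0 := by exact_mod_cast (sqrtWeight_pos s σ k).ne'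
  simp only [Pi.mul_apply]
  field_simp

theorem eLpNorm_sqrtWeight_mul_sq (s σ : ℝ) (h : ℝ → ℂ) :
    eLpNorm (fun k => (sqrtWeight s σ k : ℂ) * h k) 2 volume ^ 2 =
      ∫⁻ k, ENNReal.ofReal (gevreyWeight s σ k) * ‖h k‖ₑ ^ 2 := by
  have := eLpNorm_nnreal_pow_eq_lintegral (μ := volume) (p := 2)
    (f := fun k => (sqrtWeight s σ k : ℂ) * h k) (by norm_num)
  have h2 : ((2 : NNReal) : ℝ) = ((2 : ℕ) : ℝ) := by norm_num
  simp only [h2, ENNReal.rpow_natCast, ENNReal.coe_ofNat] at this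
  rw [this]
  refine lintegral_congr fun k => ?_
  rw [enorm_mul, mul_pow]
  congr 1
  rw [← ofReal_norm, Complex.norm_real, Real.norm_of_nonneg (sqrtWeight_pos s σ k).le,
    ← ENNReal.ofReal_pow (sqrtWeight_pos s σ k).le, sqrtWeight_sq]

theorem fourierSynth_convolution {h₁ h₂ : ℝ → ℂ} (hh₁ : Integrable h₁) (hh₂ : Integrable h₂)
    (x : ℝ) :
    fourierSynth (fun k => ((Real.sqrt (2 * Real.pi))⁻¹ : ℝ) * ∫ l, h₁ l * h₂ (k - l)) x =
      fourierSynth h₁ x * fourierSynth h₂ x := by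
  have := integral_convolution (ContinuousLinearMap.mul ℂ ℂ) (integrable_cexp_mul hh₁ x)
    (integrable_cexp_mul hh₂ x)
  simp only [convolution_def, ContinuousLinearMap.mul_apply'] at this
  unfold fourierSynth
  have key : ∀ k : ℝ, Complex.exp (Complex.I * k * x) *
      (((Real.sqrt (2 * Real.pi))⁻¹ : ℝ) * ∫ l, h₁ l * h₂ (k - l)) =
      ((Real.sqrt (2 * Real.pi))⁻¹ : ℝ) * ∫ l : ℝ, Complex.exp (Complex.I * l * x) * h₁ l *
        (Complex.exp (Complex.I * (k - l : ℝ) * x) * h₂ (k - l)) := by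
    intro k
    rw [mul_left_comm, ← integral_const_mul]
    congr 2
    funext l
    have : Complex.exp (Complex.I * k * x) =
        Complex.exp (Complex.I * l * x) * Complex.exp (Complex.I * (k - l : ℝ) * x) := by
      rw [← Complex.exp_add]; congr 1; push_cast; ring
    rw [this]; ring
  simp_rw [key]
  rw [integral_const_mul, mul_mul_mul_comm, ← this, mul_assoc]

/-- The weighted `L²` spaces above the critical exponent are convolution algebras, with a constant
that does not depend on the radius of analyticity. -/
theorem exists_gevreyBound_mul {s : ℝ} (hs : 1 / 2 < s) :
    ∃ K : ℝ, 0 ≤ K ∧ ∀ σ : ℝ, 0 ≤ σ → ∀ h₁ h₂ : ℝ → ℂ, ∀ B₁ B₂ : ℝ, 0 ≤ B₁ → 0 ≤ B₂ →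
      GevreyBound s σ h₁ B₁ → GevreyBound s σ h₂ B₂ →
      ∃ h, GevreyBound s σ h (K * B₁ * B₂) ∧
        ∀ x, fourierSynth h x = fourierSynth h₁ x * fourierSynth h₂ x := by
  obtain ⟨K, hK, H⟩ := exists_convolution_bound hs
  refine ⟨Real.sqrt K, Real.sqrt_nonneg _, ?_⟩
  intro σ hσ h₁ h₂ B₁ B₂ hB₁ hB₂ hh₁ hh₂
  wlog hm : StronglyMeasurable h₁ ∧ StronglyMeasurable h₂ generalizing h₁ h₂
  · have m₁ := aestronglyMeasurable_of_sqrtWeight_mul hh₁.1.1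
    have m₂ := aestronglyMeasurable_of_sqrtWeight_mul hh₂.1.1
    obtain ⟨h, hb, hx⟩ := this (m₁.mk h₁) (m₂.mk h₂) (hh₁.congr m₁.ae_eq_mk)
      (hh₂.congr m₂.ae_eq_mk) ⟨m₁.stronglyMeasurable_mk, m₂.stronglyMeasurable_mk⟩
    refine ⟨h, hb, fun x => ?_⟩
    rw [hx, ← fourierSynth_congr m₁.ae_eq_mk, ← fourierSynth_congr m₂.ae_eq_mk]
  have i₁ := integrable_of_memLp_sqrtWeight_mul hs hσ hh₁.1
  have i₂ := integrable_of_memLp_sqrtWeight_mul hs hσ hh₂.1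
  refine ⟨_, ?_, fun x => fourierSynth_convolution i₁ i₂ x⟩
  set h : ℝ → ℂ := fun k => ((Real.sqrt (2 * Real.pi))⁻¹ : ℝ) * ∫ l, h₁ l * h₂ (k - l) with hdef
  have hmeas : AEStronglyMeasurable h volume :=
    (i₁.integrable_convolution (ContinuousLinearMap.mul ℂ ℂ) i₂).aestronglyMeasurable.const_mul _
  have hnorm : ∀ k, ‖h k‖ₑ ≤ ∫⁻ l, ‖h₁ l‖ₑ * ‖h₂ (k - l)‖ₑ := by
    intro k
    rw [hdef]
    dsimp only
    rw [enorm_mul]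
    have hc : ‖(((Real.sqrt (2 * Real.pi))⁻¹ : ℝ) : ℂ)‖ₑ ≤ 1 := by
      rw [← ofReal_norm, Complex.norm_real, Real.norm_of_nonneg inv_sqrt_two_pi_pos.le]
      exact ENNReal.ofReal_le_one.2 inv_sqrt_two_pi_le_one
    refine (mul_le_mul' hc (enorm_integral_le_lintegral_enorm _)).trans (le_of_eq ?_)
    simp_rw [one_mul, enorm_mul]
  have hle : eLpNorm (fun k => (sqrtWeight s σ k : ℂ) * h k) 2 volume ≤
      ENNReal.ofReal (Real.sqrt K * B₁ * B₂) := by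
    rw [← ENNReal.pow_le_pow_left_iff two_ne_zero, eLpNorm_sqrtWeight_mul_sq]
    calc _ ≤ ∫⁻ k, ENNReal.ofReal (gevreyWeight s σ k) *
          (∫⁻ l, ‖h₁ l‖ₑ * ‖h₂ (k - l)‖ₑ) ^ 2 := by
          refine lintegral_mono fun k => ?_
          gcongr
          exact hnorm k
      _ ≤ ENNReal.ofReal K * (∫⁻ k, ENNReal.ofReal (gevreyWeight s σ k) * ‖h₁ k‖ₑ ^ 2) *
          ∫⁻ k, ENNReal.ofReal (gevreyWeight s σ k) * ‖h₂ k‖ₑ ^ 2 :=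
          H σ hσ _ _ hm.1.enorm hm.2.enorm
      _ ≤ ENNReal.ofReal K * ENNReal.ofReal B₁ ^ 2 * ENNReal.ofReal B₂ ^ 2 := by
          rw [← eLpNorm_sqrtWeight_mul_sq, ← eLpNorm_sqrtWeight_mul_sq]
          gcongr
          · exact hh₁.2
          · exact hh₂.2
      _ = _ := by
          rw [← ENNReal.ofReal_pow hB₁, ← ENNReal.ofReal_pow hB₂, ← ENNReal.ofReal_pow (by positivity),
            ← ENNReal.ofReal_mul hK, ← ENNReal.ofReal_mul (by positivity), mul_pow, mul_pow,
            Real.sq_sqrt hK]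
  refine ⟨⟨?_, hle.trans_lt ENNReal.ofReal_lt_top⟩, hle⟩
  exact (Complex.continuous_ofReal.comp (continuous_sqrtWeight s σ)).aestronglyMeasurable.mul hmeas

theorem sqrtWeight_mul_inv_mul (s σ k : ℝ) (z : ℂ) :
    (sqrtWeight s σ k : ℂ) * ((sqrtWeight s σ k : ℂ)⁻¹ * z) = z :=
  mul_inv_cancel_left₀ (by exact_mod_cast (sqrtWeight_pos s σ k).ne') z

/-- Synthesis at a point is a continuous linear functional on the weighted `L²` space. -/
theorem exists_synth_functional {s σ : ℝ} (hs : 1 / 2 < s) (hσ : 0 ≤ σ) (x : ℝ) :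
    ∃ L : Lp ℂ 2 (volume : Measure ℝ) →L[ℂ] ℂ, ∀ H : Lp ℂ 2 (volume : Measure ℝ),
      L H = fourierSynth (fun k => (sqrtWeight s σ k : ℂ)⁻¹ * H k) x := by
  have hm : MemLp (fun k : ℝ => (starRingEnd ℂ) (((Real.sqrt (2 * Real.pi))⁻¹ : ℝ) *
      (Complex.exp (Complex.I * k * x) * (sqrtWeight s σ k : ℂ)⁻¹))) 2 volume := by
    refine (memLp_inv_sqrtWeight hs hσ).of_le ?_ (Filter.Eventually.of_forall fun k => ?_)
    · refine (Complex.continuous_conj.comp (continuous_const.mul (Continuous.mul (by fun_prop)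
        (Continuous.inv₀ (Complex.continuous_ofReal.comp (continuous_sqrtWeight s σ))
          fun k => ?_)))).aestronglyMeasurable
      rw [Function.comp_apply]
      exact_mod_cast (sqrtWeight_pos s σ k).ne'
    · rw [RCLike.norm_conj, norm_mul, norm_mul, norm_cexp_I_mul, one_mul, Complex.norm_real,
        Real.norm_of_nonneg inv_sqrt_two_pi_pos.le]
      exact mul_le_of_le_one_left (norm_nonneg _) inv_sqrt_two_pi_le_one
  refine ⟨innerSL ℂ hm.toLp, fun H => ?_⟩
  rw [innerSL_apply_apply, L2.inner_def, fourierSynth, ← integral_const_mul]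
  refine integral_congr_ae ?_
  filter_upwards [hm.coeFn_toLp] with k hk
  rw [hk, RCLike.inner_apply, Complex.conj_conj]
  ring

theorem exists_gevreyBound_tsum {s σ : ℝ} (hs : 1 / 2 < s) (hσ : 0 ≤ σ) {ι : Type*}
    {h : ι → ℝ → ℂ} {B : ι → ℝ} (hB : ∀ i, 0 ≤ B i) (hh : ∀ i, GevreyBound s σ (h i) (B i))
    (hsum : Summable B) :
    ∃ g, GevreyBound s σ g (∑' i, B i) ∧
      ∀ x, HasSum (fun i => fourierSynth (h i) x) (fourierSynth g x) := by
  set H : ι → Lp ℂ 2 (volume : Measure ℝ) := fun i => (hh i).1.toLp with hH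
  have hn : ∀ i, ‖H i‖ ≤ B i := fun i => by
    rw [hH, Lp.norm_toLp]
    exact ENNReal.toReal_le_of_le_ofReal (hB i) (hh i).2
  have hHs : Summable H := Summable.of_norm_bounded hsum hn
  refine ⟨fun k => (sqrtWeight s σ k : ℂ)⁻¹ * (∑' i, H i) k, ⟨?_, ?_⟩, fun x => ?_⟩
  · simp_rw [sqrtWeight_mul_inv_mul]
    exact Lp.memLp _
  · simp_rw [sqrtWeight_mul_inv_mul]
    rw [← ENNReal.ofReal_toReal (Lp.memLp (∑' i, H i)).2.ne, ← Lp.norm_def]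
    exact ENNReal.ofReal_le_ofReal (tsum_of_norm_bounded hsum.hasSum hn)
  · obtain ⟨L, hL⟩ := exists_synth_functional hs hσ x
    have := hHs.hasSum.mapL L
    simp only [hL] at this
    convert this using 1
    funext i
    refine congrFun (fourierSynth_congr ?_) x
    filter_upwards [(hh i).1.coeFn_toLp] with k hk
    rw [hH, hk]
    exact (inv_mul_cancel_left₀ (by exact_mod_cast (sqrtWeight_pos s σ k).ne') _).symm

/-- Pointwise multiplication by `g` acts on the weighted `L²` space with norm at most `C`. -/
def IsMultiplier (s σ : ℝ) (g : ℝ → ℂ) (C : ℝ) : Prop :=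
  ∀ w B, 0 ≤ B → GevreyBound s σ w B →
    ∃ h, GevreyBound s σ h (C * B) ∧ ∀ x, fourierSynth h x = g x * fourierSynth w x

theorem isMultiplier_const (s σ : ℝ) (c : ℂ) : IsMultiplier s σ (fun _ => c) ‖c‖ := by
  intro w B hB hw
  refine ⟨fun k => c * w k, ⟨?_, ?_⟩, fun x => ?_⟩
  · simp_rw [mul_left_comm _ c]
    exact hw.1.const_mul c
  · simp_rw [mul_left_comm _ c]
    refine (eLpNorm_const_smul_le (c := c)).trans ?_
    rw [ENNReal.ofReal_mul (norm_nonneg c), ofReal_norm]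
    gcongr
    exact hw.2
  · unfold fourierSynth
    simp_rw [mul_left_comm _ c]
    rw [integral_const_mul, mul_left_comm]

theorem IsMultiplier.mul {s σ : ℝ} {g₁ g₂ : ℝ → ℂ} {C₁ C₂ : ℝ} (h₁ : IsMultiplier s σ g₁ C₁)
    (h₂ : IsMultiplier s σ g₂ C₂) (hC₂ : 0 ≤ C₂) :
    IsMultiplier s σ (fun x => g₁ x * g₂ x) (C₁ * C₂) := by
  intro w B hB hw
  obtain ⟨h, hb, hx⟩ := h₂ w B hB hw
  obtain ⟨h', hb', hx'⟩ := h₁ h _ (mul_nonneg hC₂ hB) hb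
  exact ⟨h', by rwa [mul_assoc], fun x => by rw [hx', hx, mul_assoc]⟩

theorem IsMultiplier.pow {s σ : ℝ} {g : ℝ → ℂ} {C : ℝ} (hg : IsMultiplier s σ g C) (hC : 0 ≤ C)
    (n : ℕ) : IsMultiplier s σ (fun x => g x ^ n) (C ^ n) := by
  induction n with
  | zero => simpa using isMultiplier_const s σ 1
  | succ n ih => simpa only [pow_succ] using ih.mul hg hC

theorem IsMultiplier.prod {s σ : ℝ} {ι : Type*} (t : Finset ι) {g : ι → ℝ → ℂ} {C : ι → ℝ}
    (hg : ∀ i, IsMultiplier s σ (g i) (C i)) (hC : ∀ i, 0 ≤ C i) :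
    IsMultiplier s σ (fun x => ∏ i ∈ t, g i x) (∏ i ∈ t, C i) := by
  classical
  induction t using Finset.induction_on with
  | empty => simpa using isMultiplier_const s σ 1
  | insert i t hi ih =>
    simp only [Finset.prod_insert hi]
    exact (hg i).mul ih (Finset.prod_nonneg fun i _ => hC i)

theorem IsMultiplier.hasSum {s σ : ℝ} (hs : 1 / 2 < s) (hσ : 0 ≤ σ) {ι : Type*} {g : ι → ℝ → ℂ}
    {C : ι → ℝ} {G : ℝ → ℂ} (hg : ∀ i, IsMultiplier s σ (g i) (C i)) (hC : ∀ i, 0 ≤ C i)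
    (hsum : Summable C) (hG : ∀ x, HasSum (fun i => g i x) (G x)) :
    IsMultiplier s σ G (∑' i, C i) := by
  intro w B hB hw
  choose h hb hx using fun i => hg i w B hB hw
  obtain ⟨H, hH, hHx⟩ := exists_gevreyBound_tsum hs hσ (fun i => mul_nonneg (hC i) hB) hb
    (hsum.mul_right B)
  refine ⟨H, by rwa [tsum_mul_right] at hH, fun x => ?_⟩
  have := hHx x
  simp only [hx] at this
  exact this.unique ((hG x).mul_right _)

/-- Composition of an entire function with elements of the weighted `L²` space acts as a
multiplier, with an entire majorant that vanishes at the origin. -/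
theorem exists_entire_multiplier_bound {s : ℝ} (hs : 1 / 2 < s) {d : ℕ} {f : (Fin d → ℂ) → ℂ}
    (hf : ∀ z, AnalyticAt ℂ f z) :
    ∃ φ : ℂ → ℂ, (∀ z, AnalyticAt ℂ φ z) ∧ φ 0 = 0 ∧
      MonotoneOn (fun x : ℝ => (φ x).re) (Set.Ici 0) ∧ (∀ x : ℝ, (φ x).im = 0) ∧
      ∀ σ : ℝ, 0 ≤ σ → ∀ a : Fin d → ℝ → ℂ, ∀ B, 0 ≤ B → (∀ j, GevreyBound s σ (a j) B) →
        IsMultiplier s σ (fun x => f (fun j => fourierSynth (a j) x) - f 0) (φ B).re := by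
  obtain ⟨K, hK, HK⟩ := exists_gevreyBound_mul hs
  obtain ⟨c, hc, hfc⟩ := exists_summable_multiindex_powerSeries d f hf
  set b : (Fin d → ℕ) → ℝ := fun α => if α = 0 then 0 else ‖c α‖ * K ^ (∑ i, α i) with hb
  have hb0 : ∀ α, 0 ≤ b α := fun α => by rw [hb]; dsimp only; split_ifs <;> positivity
  have hbn : ∀ α : Fin d → ℕ, ∑ i, α i = 0 → b α = 0 := fun α hα => by
    have : α = 0 := by
      funext i; exact (Finset.sum_eq_zero_iff.1 hα) i (Finset.mem_univ i)
    simp [hb, this]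
  have hbs : ∀ r, 0 ≤ r → Summable fun α => b α * r ^ (∑ i, α i) := fun r hr => by
    refine Summable.of_nonneg_of_le (fun α => mul_nonneg (hb0 α) (by positivity)) (fun α => ?_)
      (hc (K * r) (by positivity))
    rw [mul_pow, ← mul_assoc]
    refine mul_le_mul_of_nonneg_right ?_ (by positivity)
    rw [hb]; dsimp only; split_ifs
    · positivity
    · exact le_rfl
  obtain ⟨φ, hφ, hφ0, hφm, hφx⟩ := exists_entire_of_summable b (fun α => ∑ i, α i) hb0 hbn hbs
  refine ⟨φ, hφ, hφ0, hφm, fun x => by rw [hφx, Complex.ofReal_im], fun σ hσ a B hB ha => ?_⟩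
  have hmul : ∀ j, IsMultiplier s σ (fourierSynth (a j)) (K * B) := fun j w Bw hBw hw =>
    HK σ hσ (a j) w B Bw hB hBw (ha j) hw
  have hKB : 0 ≤ K * B := mul_nonneg hK hB
  have hf0 : f 0 = c 0 := by
    refine (hfc 0).unique ?_
    convert hasSum_single (0 : Fin d → ℕ) (f := fun α => c α * ∏ i, (0 : Fin d → ℂ) i ^ α i)
      fun α hα => ?_ using 1
    · simp
    · obtain ⟨i, hi⟩ := Function.ne_iff.1 hα
      rw [Finset.prod_eq_zero (Finset.mem_univ i) (by simpa using hi), mul_zero]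
  rw [hφx, Complex.ofReal_re]
  refine IsMultiplier.hasSum hs hσ
    (g := fun α x => (if α = 0 then 0 else c α) * ∏ i, fourierSynth (a i) x ^ α i)
    (C := fun α => b α * B ^ ∑ i, α i) (fun α => ?_)
    (fun α => mul_nonneg (hb0 α) (pow_nonneg hB _)) (hbs B hB) (fun x => ?_)
  · have hp := IsMultiplier.prod Finset.univ (fun i => (hmul i).pow hKB (α i))
      fun i => pow_nonneg hKB (α i)
    convert (isMultiplier_const s σ (if α = 0 then 0 else c α)).mul hp
      (Finset.prod_nonneg fun i _ => pow_nonneg hKB _) using 1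
    rw [Finset.prod_pow_eq_pow_sum, mul_pow, ← mul_assoc]
    congr 1
    rw [hb]; dsimp only; split_ifs <;> simp
  · have := (hfc fun j => fourierSynth (a j) x).sub (hasSum_ite_eq (0 : Fin d → ℕ) (f 0))
    refine (hasSum_congr fun α => ?_).2 this
    by_cases hα : α = 0
    · simp [hα, hf0]
    · simp [hα]

open scoped FourierTransform in
theorem integral_fourier_mul_eq_of_integrable {f g : ℝ → ℂ} (hf : Integrable f)
    (hg : Integrable g) : ∫ w, 𝓕 f w * g w = ∫ x, f x * 𝓕 g x := by
  simpa using! VectorFourier.integral_fourierIntegral_smul_eq_flip (L := innerₗ ℝ)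
    Real.continuous_fourierChar continuous_inner hf hg

open scoped FourierTransform in
theorem continuous_fourier_of_integrable {f : ℝ → ℂ} (hf : Integrable f) : Continuous (𝓕 f) :=
  VectorFourier.fourierIntegral_continuous Real.continuous_fourierChar continuous_inner hf

open scoped FourierTransform in
theorem fourierInv_fourier_ae_eq {u : ℝ → ℂ} (hu : Integrable u) (hFu : Integrable (𝓕 u)) :
    𝓕⁻ (𝓕 u) =ᵐ[volume] u := by
  have hc : Continuous (𝓕⁻ (𝓕 u)) := by
    rw [Real.fourierInv_eq_fourier_comp_neg]
    exact continuous_fourier_of_integrable hFu.comp_neg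
  refine ae_eq_of_integral_contDiff_smul_eq hc.locallyIntegrable hu.locallyIntegrable
    fun g hg hgc => ?_
  have hg₁ : HasCompactSupport (Complex.ofRealCLM ∘ g) := hgc.comp_left rfl
  have hg₂ : ContDiff ℝ (⊤ : ℕ∞) (Complex.ofRealCLM ∘ g) := Complex.ofRealCLM.contDiff.comp hg
  set ψ : SchwartzMap ℝ ℂ := hg₁.toSchwartzMap hg₂ with hψ
  have hψg : ∀ x, ψ x = g x := fun x => rfl
  have e1 := integral_fourier_mul_eq_of_integrable (𝓕⁻ ψ).integrable hu
  have e2 := integral_fourier_mul_eq_of_integrable ψ.integrable hFu.comp_neg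
  rw [← SchwartzMap.fourier_coe, FourierTransform.fourier_fourierInv_eq] at e1
  rw [← Real.fourierInv_eq_fourier_comp_neg] at e2
  simp only [hψg] at e1 e2
  simp only [Complex.real_smul]
  rw [e1, ← e2, ← integral_neg_eq_self]
  refine integral_congr_ae (Filter.Eventually.of_forall fun w => ?_)
  simp only [neg_neg, SchwartzMap.fourierInv_coe, Real.fourierInv_eq_fourier_neg]

open scoped FourierTransform in
theorem fHat_eq_fourier (u : ℝ → ℂ) (k : ℝ) :
    fHat u k = ((Real.sqrt (2 * Real.pi))⁻¹ : ℝ) * 𝓕 u (k / (2 * Real.pi)) := by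
  rw [fHat, Real.fourier_real_eq_integral_exp_smul, Complex.real_smul]
  congr 1
  refine integral_congr_ae (Filter.Eventually.of_forall fun x => ?_)
  simp only
  congr 2
  push_cast
  have : (Real.pi : ℂ) ≠ 0 := by exact_mod_cast Real.pi_ne_zero
  field_simp

open scoped FourierTransform in
theorem fourierSynth_eq_fourierInv (h : ℝ → ℂ) (x : ℝ) :
    fourierSynth h x = ((Real.sqrt (2 * Real.pi))⁻¹ : ℝ) * 𝓕⁻ h (x / (2 * Real.pi)) := by
  rw [fourierSynth, Real.fourierInv_eq']
  congr 1
  refine integral_congr_ae (Filter.Eventually.of_forall fun k => ?_)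
  simp only [smul_eq_mul, RCLike.inner_apply, conj_trivial]
  congr 2
  push_cast
  have : (Real.pi : ℂ) ≠ 0 := by exact_mod_cast Real.pi_ne_zero
  field_simp

theorem fourierSynth_fHat_ae_eq {u : ℝ → ℂ} (hu : Integrable u) (hh : Integrable (fHat u)) :
    fourierSynth (fHat u) =ᵐ[volume] u := by
  have h2π : (2 * Real.pi) ≠ 0 := by positivity
  have hs : ((Real.sqrt (2 * Real.pi))⁻¹ : ℝ) ≠ 0 := inv_sqrt_two_pi_pos.ne'
  have hFu : Integrable (FourierTransform.fourier u) := by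
    have h1 := (hh.const_mul ((((Real.sqrt (2 * Real.pi))⁻¹ : ℝ) : ℂ))⁻¹).comp_mul_left' h2π
    refine h1.congr (Filter.Eventually.of_forall fun k => ?_)
    simp only [fHat_eq_fourier]
    rw [inv_mul_cancel_left₀ (by exact_mod_cast hs), mul_div_cancel_left₀ _ h2π]
  filter_upwards [fourierInv_fourier_ae_eq hu hFu] with x hx
  rw [← hx, fourierSynth, Real.fourierInv_eq']
  have h2 := Measure.integral_comp_mul_left
    (fun k : ℝ => Complex.exp (Complex.I * k * x) * fHat u k) (2 * Real.pi)
  have h3 : ∀ v : ℝ, Complex.exp (Complex.I * (2 * Real.pi * v : ℝ) * x) *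
      fHat u (2 * Real.pi * v) = ((Real.sqrt (2 * Real.pi))⁻¹ : ℝ) *
        (Complex.exp ((2 * Real.pi * inner ℝ v x : ℝ) * Complex.I) •
          FourierTransform.fourier u v) := by
    intro v
    rw [fHat_eq_fourier, mul_div_cancel_left₀ _ h2π, mul_left_comm, smul_eq_mul]
    congr 3
    simp only [RCLike.inner_apply, conj_trivial]
    push_cast
    ring
  simp only [h3] at h2
  rw [integral_const_mul, abs_of_pos (by positivity), Complex.real_smul] at h2
  set J := ∫ v : ℝ, Complex.exp ((2 * Real.pi * inner ℝ v x : ℝ) * Complex.I) •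
    FourierTransform.fourier u v
  have h4 : ((Real.sqrt (2 * Real.pi) : ℝ) : ℂ) ^ 2 = 2 * Real.pi := by
    norm_cast
    rw [Real.sq_sqrt (by positivity)]
  have h5 : (Real.sqrt (2 * Real.pi) : ℂ) ≠ 0 := by
    exact_mod_cast (Real.sqrt_pos.2 (by positivity : 0 < 2 * Real.pi)).ne'
  have hpi : (Real.pi : ℂ) ≠ 0 := by exact_mod_cast Real.pi_ne_zero
  generalize (∫ k : ℝ, Complex.exp (Complex.I * k * x) * fHat u k) = I at h2 ⊢
  push_cast at h2 ⊢
  rw [← h4] at h2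
  field_simp at h2 ⊢
  linear_combination -h2

theorem fourierSynth_sub {h h' : ℝ → ℂ} (hh : Integrable h) (hh' : Integrable h') (x : ℝ) :
    fourierSynth (h - h') x = fourierSynth h x - fourierSynth h' x := by
  unfold fourierSynth
  rw [← mul_sub, ← integral_sub (integrable_cexp_mul hh x) (integrable_cexp_mul hh' x)]
  simp only [Pi.sub_apply, mul_sub]

theorem ae_eq_of_fourierSynth_eq {h h' : ℝ → ℂ} (hh : Integrable h) (hh' : Integrable h')
    (e : ∀ x, fourierSynth h x = fourierSynth h' x) : h =ᵐ[volume] h' := by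
  have hs : (((Real.sqrt (2 * Real.pi))⁻¹ : ℝ) : ℂ) ≠ 0 := by
    exact_mod_cast inv_sqrt_two_pi_pos.ne'
  have e0 : FourierTransform.fourier (h - h') = 0 := by
    funext y
    have := fourierSynth_sub hh hh' (-(2 * Real.pi * y))
    rw [e, sub_self, fourierSynth_eq_fourierInv, neg_div, mul_div_cancel_left₀ _ (by positivity),
      Real.fourierInv_eq_fourier_neg, neg_neg] at this
    exact (mul_eq_zero.1 this).resolve_left hs
  have := fourierInv_fourier_ae_eq (hh.sub hh') (by rw [e0]; exact integrable_zero _ _ _)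
  rw [e0] at this
  filter_upwards [this] with k hk
  have h0 : FourierTransformInv.fourierInv (0 : ℝ → ℂ) k = 0 := by
    rw [Real.fourierInv_eq']; simp
  rw [h0] at hk
  exact (sub_eq_zero.1 hk.symm)

theorem norm_cexp_I_mul_complex (k : ℝ) (z : ℂ) :
    ‖Complex.exp (Complex.I * k * z)‖ = Real.exp (-(k * z.im)) := by
  rw [Complex.norm_exp]
  congr 1
  simp

theorem hasDerivAt_integral_cexp_mul {h : ℝ → ℂ} {σ : ℝ} (hσ : 0 < σ)
    (hm : AEStronglyMeasurable h volume)
    (hi : Integrable (fun k => Real.exp (σ * |k|) * ‖h k‖)) {z : ℂ} (hz : |z.im| < σ / 2) :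
    HasDerivAt (fun z : ℂ => ∫ k : ℝ, Complex.exp (Complex.I * k * z) * h k)
      (∫ k : ℝ, Complex.exp (Complex.I * k * z) * (Complex.I * k * h k)) z := by
  have hopen : IsOpen {w : ℂ | |w.im| < σ / 2} :=
    isOpen_lt (by fun_prop) continuous_const
  have hexp : ∀ k : ℝ, ∀ w : ℂ, |w.im| < σ / 2 →
      ‖Complex.exp (Complex.I * k * w)‖ ≤ Real.exp (σ / 2 * |k|) := by
    intro k w hw
    rw [norm_cexp_I_mul_complex, Real.exp_le_exp]
    calc -(k * w.im) ≤ |k| * |w.im| := by rw [← abs_mul]; exact neg_le_abs _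
      _ ≤ _ := by rw [mul_comm]; gcongr
  have hmeas : ∀ w : ℂ, AEStronglyMeasurable
      (fun k : ℝ => Complex.exp (Complex.I * k * w)) volume := fun w =>
    Continuous.aestronglyMeasurable (by fun_prop)
  refine (hasDerivAt_integral_of_dominated_loc_of_deriv_le
    (F := fun w (k : ℝ) => Complex.exp (Complex.I * k * w) * h k)
    (F' := fun w (k : ℝ) => Complex.exp (Complex.I * k * w) * (Complex.I * k * h k))
    (bound := fun k => 2 / σ * (Real.exp (σ * |k|) * ‖h k‖))
    (hopen.mem_nhds hz) (Filter.Eventually.of_forall fun w => (hmeas w).mul hm) ?_ ?_ ?_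
    (hi.const_mul _) ?_).2
  · refine hi.mono' ((hmeas z).mul hm) (Filter.Eventually.of_forall fun k => ?_)
    rw [norm_mul]
    gcongr
    refine (hexp k z hz).trans (Real.exp_le_exp.2 ?_)
    nlinarith [abs_nonneg k]
  · exact (hmeas z).mul ((Continuous.aestronglyMeasurable (by fun_prop)).mul hm)
  · refine Filter.Eventually.of_forall fun k w hw => ?_
    simp only [norm_mul, Complex.norm_I, one_mul, Complex.norm_real, Real.norm_eq_abs]
    have h1 : |k| ≤ 2 / σ * Real.exp (σ / 2 * |k|) := by
      have := Real.add_one_le_exp (σ / 2 * |k|)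
      rw [div_mul_eq_mul_div, le_div_iff₀ hσ]
      nlinarith
    have h2 : Real.exp (σ * |k|) = Real.exp (σ / 2 * |k|) * Real.exp (σ / 2 * |k|) := by
      rw [← Real.exp_add]; congr 1; ring
    calc _ ≤ Real.exp (σ / 2 * |k|) * (2 / σ * Real.exp (σ / 2 * |k|) * ‖h k‖) := by
          gcongr
          exact hexp k w hw
      _ = _ := by rw [h2]; ring
  · refine Filter.Eventually.of_forall fun k w hw => ?_
    have h1 : HasDerivAt (fun w : ℂ => Complex.exp (Complex.I * k * w))
        (Complex.exp (Complex.I * k * w) * (Complex.I * k)) w := by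
      simpa using ((hasDerivAt_id w).const_mul (Complex.I * k)).cexp
    simpa only [mul_assoc] using h1.mul_const (h k)

theorem hasDerivAt_fourierSynth {h : ℝ → ℂ} {σ : ℝ} (hσ : 0 < σ)
    (hm : AEStronglyMeasurable h volume)
    (hi : Integrable (fun k => Real.exp (σ * |k|) * ‖h k‖)) (x : ℝ) :
    HasDerivAt (fourierSynth h) (fourierSynth (fun k => Complex.I * k * h k) x) x :=
  ((hasDerivAt_integral_cexp_mul hσ hm hi (z := x) (by simpa using hσ)).comp_ofReal).const_mul _

theorem analyticAt_fourierSynth {h : ℝ → ℂ} {σ : ℝ} (hσ : 0 < σ)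
    (hm : AEStronglyMeasurable h volume)
    (hi : Integrable (fun k => Real.exp (σ * |k|) * ‖h k‖)) (x : ℝ) :
    AnalyticAt ℝ (fourierSynth h) x := by
  have hopen : IsOpen {w : ℂ | |w.im| < σ / 2} :=
    isOpen_lt (by fun_prop) continuous_const
  have h1 : DifferentiableOn ℂ (fun z : ℂ => ∫ k : ℝ, Complex.exp (Complex.I * k * z) * h k)
      {w : ℂ | |w.im| < σ / 2} := fun w hw =>
    (hasDerivAt_integral_cexp_mul hσ hm hi hw).differentiableAt.differentiableWithinAt
  have h2 := (h1.analyticAt (hopen.mem_nhds (by simpa using hσ : |(x : ℂ).im| < σ / 2)))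
  have h3 : AnalyticAt ℝ (fun y : ℝ => (y : ℂ)) x := Complex.ofRealCLM.analyticAt x
  exact analyticAt_const.mul ((h2.restrictScalars (𝕜 := ℝ)).comp_of_eq h3 rfl)

theorem integrable_exp_mul_of_memLp {s σ : ℝ} (hs : 1 / 2 < s) {h : ℝ → ℂ}
    (hh : MemLp (fun k => (sqrtWeight s σ k : ℂ) * h k) 2) :
    Integrable (fun k => Real.exp (σ * |k|) * ‖h k‖) := by
  have h1 : Integrable (fun k => (Real.exp (σ * (1 + |k|)) : ℂ) * h k) := by
    refine integrable_of_memLp_sqrtWeight_mul (σ := 0) hs le_rfl ?_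
    refine (memLp_congr_ae (Filter.Eventually.of_forall fun k => ?_)).1 hh
    simp only [sqrtWeight, zero_mul, Real.exp_zero, one_mul]
    push_cast
    ring
  refine (h1.norm.const_mul (Real.exp (-σ))).congr (Filter.Eventually.of_forall fun k => ?_)
  simp only
  rw [norm_mul, Complex.norm_real, Real.norm_of_nonneg (Real.exp_pos _).le, ← mul_assoc,
    ← Real.exp_add]
  congr 2
  ring

section

variable {E : Type*} [NormedAddCommGroup E] [NormedSpace ℂ E]

theorem integrable_cexp_neg_smul {u : ℝ → E} (hu : Integrable u) (k : ℝ) :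
    Integrable (fun x : ℝ => Complex.exp (-(Complex.I * k * x)) • u x) := by
  refine hu.bdd_smul 1 (Continuous.aestronglyMeasurable (by fun_prop)) ?_
  refine Filter.Eventually.of_forall fun x => le_of_eq ?_
  rw [Complex.norm_exp]
  simp

theorem continuous_fHat {u : ℝ → E} (hu : Integrable u) : Continuous (fHat u) := by
  refine Continuous.const_smul (continuous_of_dominated (bound := fun x => ‖u x‖)
    (fun k => (integrable_cexp_neg_smul hu k).aestronglyMeasurable) (fun k => ?_) hu.norm
    (Filter.Eventually.of_forall fun x => by fun_prop)) _
  refine Filter.Eventually.of_forall fun x => le_of_eq ?_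
  rw [norm_smul, Complex.norm_exp]
  simp

theorem fHat_sub {u v : ℝ → E} (hu : Integrable u) (hv : Integrable v) (k : ℝ) :
    fHat (fun x => u x - v x) k = fHat u k - fHat v k := by
  unfold fHat
  rw [← smul_sub, ← integral_sub (integrable_cexp_neg_smul hu k) (integrable_cexp_neg_smul hv k)]
  simp only [smul_sub]

theorem fHat_smul (c : ℝ) (u : ℝ → E) (k : ℝ) :
    fHat (fun x => c • u x) k = c • fHat u k := by
  unfold fHat
  rw [smul_comm c, ← integral_smul c]
  simp only [smul_comm _ c]

theorem MemGevrey.aestronglyMeasurable {s σ : ℝ} {u : ℝ → E} (hu : MemGevrey s σ u) :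
    AEStronglyMeasurable (fHat u) volume :=
  (continuous_fHat hu.1).aestronglyMeasurable

theorem MemGevrey.of_le {s σ s' σ' : ℝ} {u : ℝ → E} (hu : MemGevrey s σ u)
    (hle : ∀ k, gevreyWeight s' σ' k ≤ gevreyWeight s σ k) : MemGevrey s' σ' u := by
  refine ⟨hu.1, hu.2.mono' ((continuous_gevreyWeight s' σ').aestronglyMeasurable.mul
    (hu.aestronglyMeasurable.norm.pow 2)) (Filter.Eventually.of_forall fun k => ?_)⟩
  rw [Real.norm_of_nonneg (by have := gevreyWeight_pos s' σ' k; positivity)]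
  gcongr
  exact hle k

theorem MemGevrey.sub {s σ : ℝ} {u v : ℝ → E} (hu : MemGevrey s σ u) (hv : MemGevrey s σ v) :
    MemGevrey s σ (fun x => u x - v x) := by
  refine ⟨hu.1.sub hv.1, ((hu.2.add hv.2).const_mul 2).mono'
    ((continuous_gevreyWeight s σ).aestronglyMeasurable.mul
      ((continuous_fHat (hu.1.sub hv.1)).aestronglyMeasurable.norm.pow 2))
    (Filter.Eventually.of_forall fun k => ?_)⟩
  have hw := gevreyWeight_pos s σ k
  simp only [Pi.add_apply]
  rw [Real.norm_of_nonneg (by positivity), fHat_sub hu.1 hv.1]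
  have h1 := norm_sub_le (fHat u k) (fHat v k)
  have h2 : ‖fHat u k - fHat v k‖ ^ 2 ≤ 2 * (‖fHat u k‖ ^ 2 + ‖fHat v k‖ ^ 2) := by
    nlinarith [norm_nonneg (fHat u k - fHat v k), sq_nonneg (‖fHat u k‖ - ‖fHat v k‖)]
  nlinarith

theorem MemGevrey.smul {s σ : ℝ} {u : ℝ → E} (hu : MemGevrey s σ u) (c : ℝ) :
    MemGevrey s σ (fun x => c • u x) := by
  refine ⟨hu.1.smul c, (hu.2.const_mul (c ^ 2)).congr (Filter.Eventually.of_forall fun k => ?_)⟩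
  simp only [fHat_smul, norm_smul, mul_pow, Real.norm_eq_abs, sq_abs]
  ring

end

theorem gevreyWeight_le_gevreyWeight {s s' σ σ' : ℝ} (hs : s' ≤ s) (hσ : σ' ≤ σ) (k : ℝ) :
    gevreyWeight s' σ' k ≤ gevreyWeight s σ k := by
  unfold gevreyWeight
  have : 1 ≤ 1 + k ^ 2 := by nlinarith [sq_nonneg k]
  gcongr

theorem gevreyBound_of_integrable {s σ : ℝ} {h : ℝ → ℂ} (hm : AEStronglyMeasurable h volume)
    {N : ℝ → ℝ} (hN : Integrable N) (hle : ∀ k, gevreyWeight s σ k * ‖h k‖ ^ 2 ≤ N k) :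
    GevreyBound s σ h (Real.sqrt (∫ k, N k)) := by
  have hle' : eLpNorm (fun k => (sqrtWeight s σ k : ℂ) * h k) 2 volume ≤
      ENNReal.ofReal (Real.sqrt (∫ k, N k)) := by
    have hN0 : ∀ k, 0 ≤ N k := fun k =>
      (mul_nonneg (gevreyWeight_pos s σ k).le (by positivity)).trans (hle k)
    rw [← ENNReal.pow_le_pow_left_iff two_ne_zero, eLpNorm_sqrtWeight_mul_sq,
      ← ENNReal.ofReal_pow (Real.sqrt_nonneg _), Real.sq_sqrt (integral_nonneg hN0),
      ofReal_integral_eq_lintegral_ofReal hN (Filter.Eventually.of_forall hN0)]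
    refine lintegral_mono fun k => ?_
    rw [← ofReal_norm, ← ENNReal.ofReal_pow (norm_nonneg _),
      ← ENNReal.ofReal_mul (gevreyWeight_pos s σ k).le]
    exact ENNReal.ofReal_le_ofReal (hle k)
  exact ⟨⟨(Complex.continuous_ofReal.comp (continuous_sqrtWeight s σ)).aestronglyMeasurable.mul hm,
    hle'.trans_lt ENNReal.ofReal_lt_top⟩, hle'⟩

theorem GevreyBound.integrable_sq {s σ B : ℝ} {h : ℝ → ℂ} (hh : GevreyBound s σ h B) :
    Integrable (fun k => gevreyWeight s σ k * ‖h k‖ ^ 2) := by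
  have := (memLp_two_iff_integrable_sq_norm hh.1.1).1 hh.1
  refine this.congr (Filter.Eventually.of_forall fun k => ?_)
  simp only
  rw [norm_mul, mul_pow, Complex.norm_real, Real.norm_of_nonneg (sqrtWeight_pos s σ k).le,
    sqrtWeight_sq]

theorem fHat_apply {d : ℕ} {u : ℝ → EuclideanSpace ℂ (Fin d)} (hu : Integrable u) (k : ℝ) (i : Fin d) :
    fHat u k i = fHat (fun x => u x i) k := by
  have h1 := (EuclideanSpace.proj (𝕜 := ℂ) i).integral_comp_comm (integrable_cexp_neg_smul hu k)
  simp only [EuclideanSpace.coe_proj, PiLp.smul_apply] at h1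
  unfold fHat
  rw [h1, ← Complex.coe_smul, PiLp.smul_apply, Complex.coe_smul]

theorem integrable_apply {d : ℕ} {u : ℝ → EuclideanSpace ℂ (Fin d)} (hu : Integrable u) (i : Fin d) :
    Integrable (fun x => u x i) :=
  (EuclideanSpace.proj (𝕜 := ℂ) i).integrable_comp hu

theorem MemGevrey.gevreyBound_apply {d : ℕ} {s σ : ℝ} {u : ℝ → EuclideanSpace ℂ (Fin d)}
    (hu : MemGevrey s σ u) (i : Fin d) :
    GevreyBound s σ (fun k => fHat u k i) (gevreyNorm s σ u) := by
  refine gevreyBound_of_integrable ?_ hu.2 fun k => ?_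
  · exact ((EuclideanSpace.proj (𝕜 := ℂ) i).continuous.comp
      (continuous_fHat hu.1)).aestronglyMeasurable
  · have := gevreyWeight_pos s σ k
    gcongr
    exact PiLp.norm_apply_le _ i

theorem integral_mul_le_sqrt_mul_sqrt {f g : ℝ → ℝ} (hf0 : ∀ x, 0 ≤ f x) (hg0 : ∀ x, 0 ≤ g x)
    (hf : AEStronglyMeasurable f volume) (hg : AEStronglyMeasurable g volume)
    (hf2 : Integrable fun x => f x ^ 2) (hg2 : Integrable fun x => g x ^ 2) :
    Integrable (fun x => f x * g x) ∧
      ∫ x, f x * g x ≤ Real.sqrt (∫ x, f x ^ 2) * Real.sqrt (∫ x, g x ^ 2) := by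
  have mf : MemLp f 2 := (memLp_two_iff_integrable_sq hf).2 hf2
  have mg : MemLp g 2 := (memLp_two_iff_integrable_sq hg).2 hg2
  refine ⟨mf.integrable_mul mg, ?_⟩
  have := integral_mul_le_Lp_mul_Lq_of_nonneg (μ := volume) Real.HolderConjugate.two_two
    (Filter.Eventually.of_forall hf0) (Filter.Eventually.of_forall hg0) (by simpa using mf)
    (by simpa using mg)
  simpa only [Real.rpow_two, ← Real.sqrt_eq_rpow] using this

theorem integral_gevreyWeight_mul_norm_le {E : Type*} [NormedAddCommGroup E] {s σ : ℝ} {f g : ℝ → E}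
    (hf : AEStronglyMeasurable f volume) (hg : AEStronglyMeasurable g volume)
    (hf2 : Integrable fun k => gevreyWeight s σ k * ‖f k‖ ^ 2)
    (hg2 : Integrable fun k => gevreyWeight s σ k * ‖g k‖ ^ 2) :
    Integrable (fun k => gevreyWeight s σ k * (‖f k‖ * ‖g k‖)) ∧
      ∫ k, gevreyWeight s σ k * (‖f k‖ * ‖g k‖) ≤
        Real.sqrt (∫ k, gevreyWeight s σ k * ‖f k‖ ^ 2) *
          Real.sqrt (∫ k, gevreyWeight s σ k * ‖g k‖ ^ 2) := by
  have hw := (continuous_sqrtWeight s σ).aestronglyMeasurable (μ := volume)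
  have hw0 : ∀ k, 0 ≤ sqrtWeight s σ k := fun k => (sqrtWeight_pos s σ k).le
  have e : ∀ k, (sqrtWeight s σ k * ‖f k‖) * (sqrtWeight s σ k * ‖g k‖) =
      gevreyWeight s σ k * (‖f k‖ * ‖g k‖) := fun k => by rw [← sqrtWeight_sq]; ring
  have := integral_mul_le_sqrt_mul_sqrt (f := fun k => sqrtWeight s σ k * ‖f k‖)
    (g := fun k => sqrtWeight s σ k * ‖g k‖) (fun k => mul_nonneg (hw0 k) (norm_nonneg _))
    (fun k => mul_nonneg (hw0 k) (norm_nonneg _)) (hw.mul hf.norm) (hw.mul hg.norm)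
    (by simpa only [mul_pow, sqrtWeight_sq] using hf2)
    (by simpa only [mul_pow, sqrtWeight_sq] using hg2)
  simpa only [e, mul_pow, sqrtWeight_sq] using this

theorem one_add_abs_mul_gevreyWeight_le {s σ σ₀ : ℝ} (hσ : σ ≤ σ₀) (k : ℝ) :
    (1 + |k|) * gevreyWeight s σ k ≤ 2 * gevreyWeight (s + 2) σ₀ k := by
  have h1 : (1 + |k|) ≤ 2 * (1 + k ^ 2) ^ (2 : ℝ) := by
    rw [Real.rpow_two]
    nlinarith [sq_nonneg (|k| - 1), sq_abs k, sq_nonneg (k ^ 2)]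
  have h2 := gevreyWeight_le_gevreyWeight (le_refl s) hσ k
  have h3 : gevreyWeight (s + 2) σ₀ k = gevreyWeight s σ₀ k * (1 + k ^ 2) ^ (2 : ℝ) := by
    unfold gevreyWeight
    rw [Real.rpow_add (by positivity)]
    ring
  have := gevreyWeight_pos s σ k
  have := gevreyWeight_pos s σ₀ k
  calc _ ≤ 2 * (1 + k ^ 2) ^ (2 : ℝ) * gevreyWeight s σ₀ k := by gcongr
    _ = _ := by rw [h3]; ring

theorem hasDerivAt_integral_gevreyWeight {s σ₀ η T : ℝ} (hη : 0 ≤ η) (hT : 0 < T) {f : ℝ → ℝ}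
    (hf0 : ∀ k, 0 ≤ f k) (hf : AEStronglyMeasurable f volume)
    (hf2 : Integrable fun k => gevreyWeight (s + 2) σ₀ k * f k) :
    HasDerivAt (fun S => ∫ k, gevreyWeight s (σ₀ - η * S) k * f k)
      (∫ k, -(2 * η) * ((1 + |k|) * gevreyWeight s (σ₀ - η * T) k) * f k) T := by
  have hm : ∀ S, AEStronglyMeasurable (fun k => gevreyWeight s (σ₀ - η * S) k * f k) volume :=
    fun S => (continuous_gevreyWeight _ _).aestronglyMeasurable.mul hf
  refine (hasDerivAt_integral_of_dominated_loc_of_deriv_le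
    (F := fun S k => gevreyWeight s (σ₀ - η * S) k * f k)
    (F' := fun S k => -(2 * η) * ((1 + |k|) * gevreyWeight s (σ₀ - η * S) k) * f k)
    (bound := fun k => 4 * η * (gevreyWeight (s + 2) σ₀ k * f k)) (Ioi_mem_nhds hT)
    (Filter.Eventually.of_forall hm) ?_ ?_ ?_ (hf2.const_mul _) ?_).2
  · refine hf2.mono' (hm T) (Filter.Eventually.of_forall fun k => ?_)
    rw [Real.norm_of_nonneg (mul_nonneg (gevreyWeight_pos _ _ k).le (hf0 k))]
    exact mul_le_mul_of_nonneg_right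
      (gevreyWeight_le_gevreyWeight (by linarith) (by nlinarith) k) (hf0 k)
  · refine AEStronglyMeasurable.mul ?_ hf
    exact (continuous_const.mul (Continuous.mul (by fun_prop)
      (continuous_gevreyWeight _ _))).aestronglyMeasurable
  · refine Filter.Eventually.of_forall fun k S hS => ?_
    have h1 := one_add_abs_mul_gevreyWeight_le (s := s) (σ := σ₀ - η * S) (σ₀ := σ₀)
      (by nlinarith [Set.mem_Ioi.1 hS]) k
    have h2 := gevreyWeight_pos s (σ₀ - η * S) k
    have h3 := mul_le_mul_of_nonneg_right h1 (hf0 k)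
    rw [norm_mul, norm_mul, norm_neg, Real.norm_of_nonneg (hf0 k),
      Real.norm_of_nonneg (by positivity : 0 ≤ 2 * η),
      Real.norm_of_nonneg (by positivity : 0 ≤ (1 + |k|) * gevreyWeight s (σ₀ - η * S) k)]
    nlinarith
  · refine Filter.Eventually.of_forall fun k S _ => ?_
    unfold gevreyWeight
    have h1 : HasDerivAt (fun S : ℝ => 2 * (σ₀ - η * S) * (1 + |k|)) (-(2 * η) * (1 + |k|)) S := by
      refine (((((hasDerivAt_id S).const_mul η).const_sub σ₀).const_mul 2).mul_const
        (1 + |k|)).congr_deriv ?_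
      ring
    refine ((h1.exp.mul_const ((1 + k ^ 2) ^ s)).mul_const (f k)).congr_deriv ?_
    ring

section

variable {E : Type*} [NormedAddCommGroup E] [InnerProductSpace ℂ E]

theorem norm_add_smul_sq_sub (a δ : E) (h : ℝ) :
    ‖a + (h : ℂ) • δ‖ ^ 2 - ‖a‖ ^ 2 = h * (2 * (inner ℂ a δ).re + h * ‖δ‖ ^ 2) := by
  rw [norm_add_sq (𝕜 := ℂ), inner_smul_right, norm_smul, mul_pow]
  simp
  ring

theorem hasDerivWithinAt_gevrey_energy {s σ₀ η T : ℝ} (hη : 0 ≤ η) (hT : 0 < T) {I : Set ℝ}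
    (hI : ∀ S ∈ I, 0 ≤ S) (hTI : T ∈ I) {a : ℝ → ℝ → E} {V : ℝ → E}
    (ha : ∀ S ∈ I, AEStronglyMeasurable (a S) volume) (hV : AEStronglyMeasurable V volume)
    (ha2 : ∀ S ∈ I, Integrable fun k => gevreyWeight (s + 2) σ₀ k * ‖a S k‖ ^ 2)
    (hV2 : Integrable fun k => gevreyWeight (s + 2) σ₀ k * ‖V k‖ ^ 2)
    (hq2 : ∀ S ∈ I, Integrable fun k => gevreyWeight (s + 2) σ₀ k *
      ‖((S - T)⁻¹ : ℝ) • (a S k - a T k) - V k‖ ^ 2)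
    (hlim : Filter.Tendsto (fun S => ∫ k, gevreyWeight (s + 2) σ₀ k *
      ‖((S - T)⁻¹ : ℝ) • (a S k - a T k) - V k‖ ^ 2) (nhdsWithin T (I \ {T})) (nhds 0)) :
    HasDerivWithinAt (fun S => ∫ k, gevreyWeight s (σ₀ - η * S) k * ‖a S k‖ ^ 2)
      ((∫ k, -(2 * η) * ((1 + |k|) * gevreyWeight s (σ₀ - η * T) k) * ‖a T k‖ ^ 2) +
        ∫ k, gevreyWeight s (σ₀ - η * T) k * (2 * (inner ℂ (a T k) (V k)).re)) I T := by
  set W := gevreyWeight (s + 2) σ₀ with hW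
  set ρ : ℝ → ℝ → ℝ := fun S => gevreyWeight s (σ₀ - η * S) with hρ
  set q : ℝ → ℝ → E := fun S k => ((S - T)⁻¹ : ℝ) • (a S k - a T k) - V k with hq
  have hρW : ∀ S, 0 ≤ S → ∀ k, ρ S k ≤ W k := fun S hS k =>
    gevreyWeight_le_gevreyWeight (by linarith) (by nlinarith) k
  have hρ0 : ∀ S k, 0 < ρ S k := fun S k => gevreyWeight_pos _ _ k
  have hW0 : ∀ k, 0 < W k := fun k => gevreyWeight_pos _ _ k
  have hρm : ∀ S, AEStronglyMeasurable (ρ S) volume := fun S =>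
    (continuous_gevreyWeight _ _).aestronglyMeasurable
  have hqm : ∀ S ∈ I, AEStronglyMeasurable (q S) volume := fun S hS =>
    (((ha S hS).sub (ha T hTI)).const_smul _).sub hV
  have haV := integral_gevreyWeight_mul_norm_le (ha T hTI) hV (ha2 T hTI) hV2
  have haq := fun S hS => integral_gevreyWeight_mul_norm_le (ha T hTI) (hqm S hS) (ha2 T hTI)
    (hq2 S hS)
  have hintT : ∀ S ∈ I, Integrable fun k => ρ S k * ‖a T k‖ ^ 2 := fun S hS =>
    (ha2 T hTI).mono' ((hρm S).mul ((ha T hTI).norm.pow 2)) (Filter.Eventually.of_forall fun k => by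
      rw [Real.norm_of_nonneg (mul_nonneg (hρ0 S k).le (by positivity))]
      gcongr; exact hρW S (hI S hS) k)
  have hre : ∀ x y : E, |(inner ℂ x y).re| ≤ ‖x‖ * ‖y‖ := fun x y =>
    (Complex.abs_re_le_norm _).trans (norm_inner_le_norm x y)
  have hbound : ∀ S, 0 ≤ S → ∀ k, ‖ρ S k * (2 * (inner ℂ (a T k) (V k)).re)‖ ≤
      2 * (W k * (‖a T k‖ * ‖V k‖)) := fun S hS k => by
    rw [norm_mul, norm_mul, Real.norm_of_nonneg (hρ0 S k).le, Real.norm_two, Real.norm_eq_abs]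
    have := hρW S hS k
    have := hW0 k
    calc _ ≤ W k * (2 * (‖a T k‖ * ‖V k‖)) := by gcongr; exact hre _ _
      _ = _ := by ring
  have hinner : AEStronglyMeasurable (fun k => 2 * (inner ℂ (a T k) (V k)).re) volume :=
    (Complex.continuous_re.comp_aestronglyMeasurable ((ha T hTI).inner hV)).const_mul 2
  have hcross : Filter.Tendsto (fun S => ∫ k, ρ S k * (2 * (inner ℂ (a T k) (V k)).re))
      (nhdsWithin T (I \ {T})) (nhds (∫ k, ρ T k * (2 * (inner ℂ (a T k) (V k)).re))) := by
    refine tendsto_integral_filter_of_dominated_convergence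
      (fun k => 2 * (W k * (‖a T k‖ * ‖V k‖)))
      (Filter.Eventually.of_forall fun S => (hρm S).mul hinner) ?_ (haV.1.const_mul 2) ?_
    · filter_upwards [self_mem_nhdsWithin] with S hS
      exact Filter.Eventually.of_forall (hbound S (hI S hS.1))
    · refine Filter.Eventually.of_forall fun k => ?_
      have : Continuous fun S => ρ S k * (2 * (inner ℂ (a T k) (V k)).re) := by
        rw [hρ]; unfold gevreyWeight; fun_prop
      exact this.continuousAt.tendsto.mono_left nhdsWithin_le_nhds
  have hA := (hasDerivAt_integral_gevreyWeight (s := s) hη hT (fun k => sq_nonneg ‖a T k‖)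
    ((ha T hTI).norm.pow 2) (ha2 T hTI)).hasDerivWithinAt (s := I)
  rw [hasDerivWithinAt_iff_tendsto_slope] at hA ⊢
  set Q : ℝ → ℝ := fun S => ∫ k, W k * ‖q S k‖ ^ 2 with hQ
  set A := ∫ k, W k * ‖a T k‖ ^ 2
  set B := ∫ k, W k * ‖V k‖ ^ 2
  set R : ℝ → ℝ → ℝ := fun S k =>
    ρ S k * (2 * (inner ℂ (a T k) (q S k)).re + (S - T) * ‖V k + q S k‖ ^ 2) with hR
  have hRm : ∀ S ∈ I, AEStronglyMeasurable (R S) volume := fun S hS =>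
    (hρm S).mul (((Complex.continuous_re.comp_aestronglyMeasurable
      ((ha T hTI).inner (hqm S hS))).const_mul 2).add (((hV.add (hqm S hS)).norm.pow 2).const_mul _))
  set bd : ℝ → ℝ → ℝ := fun S k => 2 * (W k * (‖a T k‖ * ‖q S k‖)) +
    |S - T| * (2 * (W k * ‖V k‖ ^ 2 + W k * ‖q S k‖ ^ 2)) with hbd
  have hbdi : ∀ S ∈ I, Integrable (bd S) := fun S hS =>
    ((haq S hS).1.const_mul 2).add (((hV2.add (hq2 S hS)).const_mul 2).const_mul _)
  have hRbd : ∀ S ∈ I, ∀ k, ‖R S k‖ ≤ bd S k := by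
    intro S hS k
    have h1 := hρW S (hI S hS) k
    have h2 := hW0 k
    have h3 : ‖V k + q S k‖ ^ 2 ≤ 2 * (‖V k‖ ^ 2 + ‖q S k‖ ^ 2) := by
      nlinarith [norm_add_le (V k) (q S k), norm_nonneg (V k + q S k),
        sq_nonneg (‖V k‖ - ‖q S k‖)]
    have h4 : ‖2 * (inner ℂ (a T k) (q S k)).re + (S - T) * ‖V k + q S k‖ ^ 2‖ ≤
        2 * (‖a T k‖ * ‖q S k‖) + |S - T| * (2 * (‖V k‖ ^ 2 + ‖q S k‖ ^ 2)) := by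
      refine (norm_add_le _ _).trans ?_
      rw [norm_mul, norm_mul, Real.norm_two, Real.norm_eq_abs, Real.norm_eq_abs,
        Real.norm_of_nonneg (sq_nonneg _)]
      gcongr
      exact hre _ _
    rw [hR]
    dsimp only
    rw [norm_mul, Real.norm_of_nonneg (hρ0 S k).le]
    calc _ ≤ W k * (2 * (‖a T k‖ * ‖q S k‖) + |S - T| * (2 * (‖V k‖ ^ 2 + ‖q S k‖ ^ 2))) := by
          gcongr
      _ = _ := by rw [hbd]; ring
  have hRi : ∀ S ∈ I, Integrable (R S) := fun S hS =>
    (hbdi S hS).mono' (hRm S hS) (Filter.Eventually.of_forall (hRbd S hS))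
  have hRlim : Filter.Tendsto (fun S => ∫ k, R S k) (nhdsWithin T (I \ {T})) (nhds 0) := by
    have hlim2 : Filter.Tendsto (fun S => 2 * (Real.sqrt A * Real.sqrt (Q S)) +
        |S - T| * (2 * (B + Q S))) (nhdsWithin T (I \ {T})) (nhds 0) := by
      have hsub : Filter.Tendsto (fun S => |S - T|) (nhdsWithin T (I \ {T})) (nhds 0) := by
        have : Continuous fun S => |S - T| := by fun_prop
        have := this.tendsto T
        rw [sub_self, abs_zero] at this
        exact this.mono_left nhdsWithin_le_nhds
      have hsq := (Real.continuous_sqrt.tendsto 0).comp hlim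
      have := ((hsq.const_mul (Real.sqrt A)).const_mul 2).add
        (hsub.mul ((hlim.const_add B).const_mul 2))
      simpa using this
    refine squeeze_zero_norm' ?_ hlim2
    filter_upwards [self_mem_nhdsWithin] with S hS
    refine (norm_integral_le_of_norm_le (hbdi S hS.1)
      (Filter.Eventually.of_forall (hRbd S hS.1))).trans ?_
    have e1 : ∫ k, bd S k = (∫ k, 2 * (W k * (‖a T k‖ * ‖q S k‖))) +
        ∫ k, |S - T| * (2 * (W k * ‖V k‖ ^ 2 + W k * ‖q S k‖ ^ 2)) :=
      integral_add ((haq S hS.1).1.const_mul 2)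
        (((hV2.add (hq2 S hS.1)).const_mul 2).const_mul _)
    have e2 : ∫ k, W k * ‖V k‖ ^ 2 + W k * ‖q S k‖ ^ 2 = B + Q S :=
      integral_add hV2 (hq2 S hS.1)
    rw [e1, integral_const_mul, integral_const_mul, integral_const_mul, e2]
    gcongr
    exact (haq S hS.1).2
  have hsum := (hA.add (hcross.add hRlim))
  rw [add_zero] at hsum
  refine hsum.congr' ?_
  filter_upwards [self_mem_nhdsWithin] with S hS
  have hST : S - T ≠ 0 := sub_ne_zero.2 hS.2
  have hpt : ∀ k, ρ S k * ‖a S k‖ ^ 2 = ρ S k * ‖a T k‖ ^ 2 +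
      (S - T) * (ρ S k * (2 * (inner ℂ (a T k) (V k)).re) + R S k) := by
    intro k
    have h1 : a S k = a T k + ((S - T : ℝ) : ℂ) • (V k + q S k) := by
      rw [hq]
      dsimp only
      rw [add_sub_cancel, Complex.coe_smul, smul_inv_smul₀ hST, add_sub_cancel]
    have h2 := norm_add_smul_sq_sub (a T k) (V k + q S k) (S - T)
    rw [← h1, inner_add_right, Complex.add_re] at h2
    rw [hR]
    dsimp only
    linear_combination (ρ S k) * h2
  have hVi : Integrable fun k => ρ S k * (2 * (inner ℂ (a T k) (V k)).re) :=
    (haV.1.const_mul 2).mono' ((hρm S).mul hinner)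
      (Filter.Eventually.of_forall (hbound S (hI S hS.1)))
  have e1 : ∫ k, ρ S k * ‖a S k‖ ^ 2 = (∫ k, ρ S k * ‖a T k‖ ^ 2) +
      ∫ k, (S - T) * (ρ S k * (2 * (inner ℂ (a T k) (V k)).re) + R S k) := by
    rw [funext hpt]
    exact integral_add (hintT S hS.1) ((hVi.add (hRi S hS.1)).const_mul _)
  have e2 : ∫ k, (ρ S k * (2 * (inner ℂ (a T k) (V k)).re) + R S k) = _ :=
    integral_add hVi (hRi S hS.1)
  rw [integral_const_mul, e2] at e1
  have e3 : ∫ k, gevreyWeight s (σ₀ - η * S) k * ‖a S k‖ ^ 2 =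
      (∫ k, gevreyWeight s (σ₀ - η * S) k * ‖a T k‖ ^ 2) + _ := e1
  simp only [slope_def_field]
  rw [e3]
  field_simp
  ring_nf

end

theorem MemGevrey.integrable_fHat_apply {d : ℕ} {s σ : ℝ} (hs : 1 / 2 < s) (hσ : 0 ≤ σ)
    {u : ℝ → EuclideanSpace ℂ (Fin d)} (hu : MemGevrey s σ u) (i : Fin d) :
    Integrable (fun k => fHat u k i) :=
  integrable_of_memLp_sqrtWeight_mul hs hσ (hu.gevreyBound_apply i).1

theorem exists_norm_fourierSynth_le (d : ℕ) {s σ : ℝ} (hs : 1 / 2 < s) (hσ : 0 ≤ σ) :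
    ∃ C : ℝ, ∀ u : ℝ → EuclideanSpace ℂ (Fin d), MemGevrey s σ u → ∀ i x,
      ‖fourierSynth (fun k => fHat u k i) x‖ ≤ C * gevreyNorm s σ u := by
  refine ⟨Real.sqrt (∫ k, (sqrtWeight s σ k)⁻¹ ^ 2), fun u hu i x => ?_⟩
  have hc := continuous_sqrtWeight s σ
  have hp := sqrtWeight_pos s σ
  have h1 : Integrable fun k => (sqrtWeight s σ k)⁻¹ ^ 2 := by
    have := (memLp_two_iff_integrable_sq_norm (memLp_inv_sqrtWeight hs hσ).1).1
      (memLp_inv_sqrtWeight hs hσ)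
    refine this.congr (Filter.Eventually.of_forall fun k => ?_)
    simp
  have e : ∀ k, (sqrtWeight s σ k * ‖fHat u k‖) ^ 2 = gevreyWeight s σ k * ‖fHat u k‖ ^ 2 :=
    fun k => by rw [mul_pow, sqrtWeight_sq]
  have h2 := integral_mul_le_sqrt_mul_sqrt (f := fun k => (sqrtWeight s σ k)⁻¹)
    (g := fun k => sqrtWeight s σ k * ‖fHat u k‖) (fun k => (inv_pos.2 (hp k)).le)
    (fun k => mul_nonneg (hp k).le (norm_nonneg _))
    (hc.inv₀ fun k => (hp k).ne').aestronglyMeasurable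
    (hc.aestronglyMeasurable.mul hu.aestronglyMeasurable.norm) h1 (by simpa only [e] using hu.2)
  simp only [e, inv_mul_cancel_left₀ (hp _).ne'] at h2
  refine (norm_fourierSynth_le _ x).trans (le_trans ?_ h2.2)
  exact integral_mono (hu.integrable_fHat_apply hs hσ i).norm h2.1
    fun k => PiLp.norm_apply_le (fHat u k) i

theorem MemGevrey.fourierSynth_ae_eq {d : ℕ} {s σ : ℝ} (hs : 1 / 2 < s) (hσ : 0 ≤ σ)
    {u : ℝ → EuclideanSpace ℂ (Fin d)} (hu : MemGevrey s σ u) (i : Fin d) :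
    fourierSynth (fun k => fHat u k i) =ᵐ[volume] fun x => u x i := by
  have h1 := hu.integrable_fHat_apply hs hσ i
  simp only [fHat_apply hu.1] at h1 ⊢
  exact fourierSynth_fHat_ae_eq (integrable_apply hu.1 i) h1

theorem ae_eq_of_tendsto_gevreyNorm_slope {d : ℕ} {s σ T : ℝ} (hs : 1 / 2 < s) (hσ : 0 ≤ σ)
    {I : Set ℝ} (hT : T ∈ I) [(nhdsWithin T (I \ {T})).NeBot]
    {u : ℝ → ℝ → EuclideanSpace ℂ (Fin d)} {v : ℝ → EuclideanSpace ℂ (Fin d)}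
    (hu : ∀ S ∈ I, MemGevrey s σ (u S)) (hv : MemGevrey s σ v)
    (hlim : Filter.Tendsto (fun S => gevreyNorm s σ (fun x => (S - T)⁻¹ • (u S x - u T x) - v x))
      (nhdsWithin T (I \ {T})) (nhds 0))
    {D : ℝ → Fin d → ℂ} (hD : ∀ x i, HasDerivAt (fun S => u S x i) (D x i) T) :
    ∀ᵐ x : ℝ, ∀ i, v x i = D x i := by
  obtain ⟨C, hC⟩ := exists_norm_fourierSynth_le d hs hσ
  obtain ⟨S, hS⟩ := Filter.exists_seq_tendsto (nhdsWithin T (I \ {T}))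
  have hSI : ∀ᶠ n in Filter.atTop, S n ∈ I \ {T} := hS.eventually self_mem_nhdsWithin
  set q : ℝ → ℝ → EuclideanSpace ℂ (Fin d) :=
    fun S x => (S - T)⁻¹ • (u S x - u T x) - v x with hq
  have hqm : ∀ S ∈ I, MemGevrey s σ (q S) := fun S hS =>
    (((hu S hS).sub (hu T hT)).smul _).sub hv
  have hae : ∀ᵐ x : ℝ, ∀ i n, S n ∈ I → fourierSynth (fun k => fHat (q (S n)) k i) x =
      q (S n) x i := by
    rw [ae_all_iff]
    intro i
    rw [ae_all_iff]
    intro n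
    by_cases h : S n ∈ I
    · filter_upwards [(hqm _ h).fourierSynth_ae_eq hs hσ i] with x hx _ using hx
    · exact Filter.Eventually.of_forall fun x hx => absurd hx h
  filter_upwards [hae] with x hx i
  have h0 : Filter.Tendsto (fun n => q (S n) x i) Filter.atTop (nhds 0) := by
    have hlim' := (hlim.comp hS).const_mul C
    rw [mul_zero] at hlim'
    refine squeeze_zero_norm' ?_ hlim'
    filter_upwards [hSI] with n hn
    rw [← hx i n hn.1]
    exact hC _ (hqm _ hn.1) i x
  have h1 : Filter.Tendsto (fun n => q (S n) x i) Filter.atTop (nhds (D x i - v x i)) := by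
    have := (hasDerivAt_iff_tendsto_slope.1 (hD x i)).comp
      (hS.mono_right (nhdsWithin_mono T fun y hy => hy.2))
    refine (this.sub_const (v x i)).congr fun n => ?_
    simp [hq, slope_def_module]
  exact (sub_eq_zero.1 (tendsto_nhds_unique h1 h0)).symm

theorem frequently_nhdsNE_of_ae {p : ℝ → Prop} (h : ∀ᵐ x : ℝ, p x) (x₀ : ℝ) :
    ∃ᶠ x in nhdsWithin x₀ {x₀}ᶜ, p x := by
  have h1 : ∀ᵐ x : ℝ, p x ∧ x ∈ ({x₀}ᶜ : Set ℝ) :=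
    h.and (compl_mem_ae_iff.2 (measure_singleton x₀))
  have h2 := mem_closure_iff_frequently.1 (Measure.dense_of_ae h1 x₀)
  rw [frequently_nhdsWithin_iff]
  exact h2

theorem deriv_eq_zero_or_of_ae_eq {f g : ℝ → ℂ} (h : f =ᵐ[volume] g) {x : ℝ} {g' : ℂ}
    (hg : HasDerivAt g g' x) : deriv f x = 0 ∨ deriv f x = g' := by
  by_cases hf : DifferentiableAt ℝ f x
  · right
    have h1 : deriv (f - g) x = 0 :=
      deriv_zero_of_frequently_const (c := 0) ((frequently_nhdsNE_of_ae h x).mono fun y hy => by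
        simp [hy])
    rw [deriv_sub hf hg.differentiableAt, hg.deriv] at h1
    exact sub_eq_zero.1 h1
  · exact Or.inl (deriv_zero_of_not_differentiableAt hf)

theorem exists_forall_eq_of_ae_exists {ι κ : Type*} [Finite ι] [Finite κ] {F : κ → ℝ → ℂ}
    {G : ι → κ → ℝ → ℂ} (hF : ∀ j x, AnalyticAt ℝ (F j) x) (hG : ∀ i j x, AnalyticAt ℝ (G i j) x)
    (h : ∀ᵐ x : ℝ, ∃ i, ∀ j, F j x = G i j x) : ∃ i, ∀ j x, F j x = G i j x := by
  have h1 : ∃ i, ∃ᶠ x in nhdsWithin (0 : ℝ) {0}ᶜ, ∀ j, F j x = G i j x := by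
    by_contra! hc
    refine frequently_nhdsNE_of_ae h 0 ?_
    filter_upwards [Filter.eventually_all.2 hc] with x hx
    simpa using hx
  obtain ⟨i, hi⟩ := h1
  refine ⟨i, fun j x => ?_⟩
  have := AnalyticOnNhd.eq_of_frequently_eq (𝕜 := ℝ) (f := F j) (g := G i j) (z₀ := 0)
    (fun x _ => hF j x) (fun x _ => hG i j x) (hi.mono fun x hx => hx j)
  exact congrFun this x

theorem gevreyWeight_add_half (s σ k : ℝ) :
    gevreyWeight (s + 1 / 2) σ k = gevreyWeight s σ k * Real.sqrt (1 + k ^ 2) := by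
  unfold gevreyWeight
  rw [Real.rpow_add (by positivity), ← Real.sqrt_eq_rpow, ← mul_assoc]

theorem sqrtWeight_half_mul (s σ k : ℝ) :
    sqrtWeight (s + 1 / 2) σ k * sqrtWeight (s - 1 / 2) σ k = gevreyWeight s σ k := by
  unfold sqrtWeight gevreyWeight
  rw [mul_mul_mul_comm, ← Real.exp_add, ← Real.rpow_add (by positivity)]
  ring_nf

theorem integral_gevreyWeight_mul_norm_le_of_gevreyBound {E : Type*} [NormedAddCommGroup E]
    {s σ C : ℝ} (hC : 0 ≤ C) {a : ℝ → E} {h : ℝ → ℂ} (ha : AEStronglyMeasurable a volume)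
    (ha2 : Integrable fun k => gevreyWeight (s + 1 / 2) σ k * ‖a k‖ ^ 2)
    (hh : GevreyBound (s - 1 / 2) σ h
      (C * Real.sqrt (∫ k, gevreyWeight (s + 1 / 2) σ k * ‖a k‖ ^ 2))) :
    Integrable (fun k => gevreyWeight s σ k * (‖a k‖ * ‖h k‖)) ∧
      ∫ k, gevreyWeight s σ k * (‖a k‖ * ‖h k‖) ≤
        C * ∫ k, gevreyWeight (s + 1 / 2) σ k * ‖a k‖ ^ 2 := by
  set N := ∫ k, gevreyWeight (s + 1 / 2) σ k * ‖a k‖ ^ 2 with hN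
  have hN0 : 0 ≤ N := integral_nonneg fun k =>
    mul_nonneg (gevreyWeight_pos _ _ k).le (sq_nonneg _)
  have e1 : ∀ k, (sqrtWeight (s + 1 / 2) σ k * ‖a k‖) ^ 2 =
      gevreyWeight (s + 1 / 2) σ k * ‖a k‖ ^ 2 := fun k => by rw [mul_pow, sqrtWeight_sq]
  have e2 : ∀ k, (sqrtWeight (s - 1 / 2) σ k * ‖h k‖) ^ 2 =
      gevreyWeight (s - 1 / 2) σ k * ‖h k‖ ^ 2 := fun k => by rw [mul_pow, sqrtWeight_sq]
  have e3 : ∀ k, sqrtWeight (s + 1 / 2) σ k * ‖a k‖ * (sqrtWeight (s - 1 / 2) σ k * ‖h k‖) =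
      gevreyWeight s σ k * (‖a k‖ * ‖h k‖) := fun k => by
    rw [← sqrtWeight_half_mul]; ring
  have hle := integral_mul_le_sqrt_mul_sqrt (f := fun k => sqrtWeight (s + 1 / 2) σ k * ‖a k‖)
    (g := fun k => sqrtWeight (s - 1 / 2) σ k * ‖h k‖)
    (fun k => mul_nonneg (sqrtWeight_pos _ _ k).le (norm_nonneg _))
    (fun k => mul_nonneg (sqrtWeight_pos _ _ k).le (norm_nonneg _))
    ((continuous_sqrtWeight _ _).aestronglyMeasurable.mul ha.norm)
    ((continuous_sqrtWeight _ _).aestronglyMeasurable.mul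
      (aestronglyMeasurable_of_sqrtWeight_mul hh.1.1).norm)
    (by simpa only [e1] using ha2) (by simpa only [e2] using hh.integrable_sq)
  simp only [e1, e2, e3] at hle
  refine ⟨hle.1, hle.2.trans ?_⟩
  have h2 := hh.2
  rw [← ENNReal.pow_le_pow_left_iff two_ne_zero, eLpNorm_sqrtWeight_mul_sq,
    ← ENNReal.ofReal_pow (by positivity), mul_pow, Real.sq_sqrt hN0] at h2
  have h3 : ∫ k, gevreyWeight (s - 1 / 2) σ k * ‖h k‖ ^ 2 ≤ C ^ 2 * N := by
    rw [← ENNReal.ofReal_le_ofReal_iff (by positivity),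
      ofReal_integral_eq_lintegral_ofReal hh.integrable_sq (Filter.Eventually.of_forall fun k =>
        mul_nonneg (gevreyWeight_pos _ _ k).le (sq_nonneg _))]
    refine le_trans (lintegral_mono fun k => le_of_eq ?_) h2
    rw [← ofReal_norm, ← ENNReal.ofReal_pow (norm_nonneg _),
      ← ENNReal.ofReal_mul (gevreyWeight_pos _ σ k).le]
  calc _ ≤ Real.sqrt N * Real.sqrt (C ^ 2 * N) := by gcongr
    _ = C * N := by
      rw [Real.sqrt_mul (sq_nonneg _), Real.sqrt_sq hC, mul_left_comm, Real.mul_self_sqrt hN0]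

theorem integral_energy_le {E : Type*} [NormedAddCommGroup E] [InnerProductSpace ℂ E]
    {s σ η μ : ℝ} (hη : 0 ≤ η) (hμ : 0 ≤ μ) {a V : ℝ → E}
    (ha : AEStronglyMeasurable a volume) (hV : AEStronglyMeasurable V volume)
    (ha2 : Integrable fun k => gevreyWeight (s + 1 / 2) σ k * ‖a k‖ ^ 2)
    (hV2 : Integrable fun k => gevreyWeight s σ k * ‖V k‖ ^ 2)
    {ι : Type*} {P : Finset ι} {h : ι → ℝ → ℂ} {C : ι → ℝ} (hC : ∀ i ∈ P, 0 ≤ C i)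
    (hh : ∀ i ∈ P, GevreyBound (s - 1 / 2) σ (h i)
      (C i * Real.sqrt (∫ k, gevreyWeight (s + 1 / 2) σ k * ‖a k‖ ^ 2)))
    (hle : ∀ᵐ k, (inner ℂ (a k) (V k)).re ≤
      μ * (|k| * ‖a k‖ ^ 2) + ∑ i ∈ P, ‖a k‖ * ‖h i k‖) :
    (∫ k, -(2 * η) * ((1 + |k|) * gevreyWeight s σ k) * ‖a k‖ ^ 2) +
        ∫ k, gevreyWeight s σ k * (2 * (inner ℂ (a k) (V k)).re) ≤
      -(2 * (η - μ - ∑ i ∈ P, C i)) * ∫ k, gevreyWeight (s + 1 / 2) σ k * ‖a k‖ ^ 2 := by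
  set N := ∫ k, gevreyWeight (s + 1 / 2) σ k * ‖a k‖ ^ 2 with hN
  have hw := gevreyWeight_pos s σ
  have hwm := (continuous_gevreyWeight s σ).aestronglyMeasurable (μ := volume)
  have hk1 : ∀ k : ℝ, |k| ≤ Real.sqrt (1 + k ^ 2) := fun k =>
    Real.abs_le_sqrt (by linarith)
  have hk2 : ∀ k : ℝ, Real.sqrt (1 + k ^ 2) ≤ 1 + |k| := fun k =>
    Real.sqrt_le_iff.2 ⟨by positivity, by nlinarith [sq_abs k, abs_nonneg k]⟩
  have hk3 : ∀ k : ℝ, 1 + |k| ≤ 2 * Real.sqrt (1 + k ^ 2) := fun k => by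
    have : 1 ≤ Real.sqrt (1 + k ^ 2) := Real.one_le_sqrt.2 (by nlinarith)
    linarith [hk1 k]
  have hsW : ∀ k, gevreyWeight s σ k ≤ gevreyWeight (s + 1 / 2) σ k := fun k =>
    gevreyWeight_le_gevreyWeight (by linarith) le_rfl k
  have ha0 : Integrable fun k => gevreyWeight s σ k * ‖a k‖ ^ 2 :=
    ha2.mono' (hwm.mul (ha.norm.pow 2)) (Filter.Eventually.of_forall fun k => by
      rw [Real.norm_of_nonneg (mul_nonneg (hw k).le (sq_nonneg _))]
      exact mul_le_mul_of_nonneg_right (hsW k) (sq_nonneg _))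
  have hi1 : Integrable fun k => -(2 * η) * ((1 + |k|) * gevreyWeight s σ k) * ‖a k‖ ^ 2 := by
    refine (ha2.const_mul (4 * η)).mono' ?_ (Filter.Eventually.of_forall fun k => ?_)
    · exact (((Continuous.aestronglyMeasurable (by fun_prop)).mul hwm).const_mul _).mul
        (ha.norm.pow 2)
    · have := hw k
      rw [norm_mul, norm_mul, norm_neg, Real.norm_of_nonneg (sq_nonneg ‖a k‖),
        Real.norm_of_nonneg (by positivity : 0 ≤ 2 * η),
        Real.norm_of_nonneg (by positivity : 0 ≤ (1 + |k|) * gevreyWeight s σ k),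
        gevreyWeight_add_half]
      calc _ ≤ 2 * η * ((2 * Real.sqrt (1 + k ^ 2)) * gevreyWeight s σ k) * ‖a k‖ ^ 2 := by
            gcongr; exact hk3 k
        _ = _ := by ring
  have hi2 : Integrable fun k => gevreyWeight s σ k * (2 * (inner ℂ (a k) (V k)).re) := by
    refine ((integral_gevreyWeight_mul_norm_le ha hV ha0 hV2).1.const_mul 2).mono'
      (hwm.mul ((Complex.continuous_re.comp_aestronglyMeasurable (ha.inner hV)).const_mul 2))
      (Filter.Eventually.of_forall fun k => ?_)
    have := hw k
    rw [norm_mul, norm_mul, Real.norm_two, Real.norm_of_nonneg (hw k).le, Real.norm_eq_abs]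
    calc _ ≤ gevreyWeight s σ k * (2 * (‖a k‖ * ‖V k‖)) := by
          gcongr; exact (Complex.abs_re_le_norm _).trans (norm_inner_le_norm _ _)
      _ = _ := by ring
  have hb := fun i hi => integral_gevreyWeight_mul_norm_le_of_gevreyBound (hC i hi) ha ha2 (hh i hi)
  have hi3 : Integrable fun k => ∑ i ∈ P, gevreyWeight s σ k * (‖a k‖ * ‖h i k‖) :=
    integrable_finsetSum _ fun i hi => (hb i hi).1
  rw [← integral_add hi1 hi2]
  calc _ ≤ ∫ k, -(2 * (η - μ)) * (gevreyWeight (s + 1 / 2) σ k * ‖a k‖ ^ 2) +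
        2 * ∑ i ∈ P, gevreyWeight s σ k * (‖a k‖ * ‖h i k‖) := by
        refine integral_mono_ae (hi1.add hi2) ((ha2.const_mul _).add (hi3.const_mul 2)) ?_
        filter_upwards [hle] with k hk
        have h1 := mul_le_mul_of_nonneg_left hk (hw k).le
        have h2 := mul_le_mul_of_nonneg_left (hk1 k)
          (mul_nonneg hμ (mul_nonneg (hw k).le (sq_nonneg ‖a k‖)))
        have h3 := mul_le_mul_of_nonneg_left (hk2 k)
          (mul_nonneg hη (mul_nonneg (hw k).le (sq_nonneg ‖a k‖)))
        rw [gevreyWeight_add_half, ← Finset.mul_sum]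
        linarith
    _ = -(2 * (η - μ)) * N + 2 * ∑ i ∈ P, ∫ k, gevreyWeight s σ k * (‖a k‖ * ‖h i k‖) := by
        rw [integral_add (ha2.const_mul _) (hi3.const_mul 2), integral_const_mul,
          integral_const_mul, integral_finsetSum _ fun i hi => (hb i hi).1]
    _ ≤ -(2 * (η - μ)) * N + 2 * ∑ i ∈ P, C i * N := by
        gcongr with i hi
        exact (hb i hi).2
    _ = _ := by rw [← Finset.sum_mul]; ring

theorem norm_toLp_map_mulVec_le {d : ℕ} (A : Matrix (Fin d) (Fin d) ℝ)
    (b : EuclideanSpace ℂ (Fin d)) :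
    ‖WithLp.toLp 2 (fun i => ∑ j, (A i j : ℂ) * b j)‖ ≤ matOpNorm A * ‖b‖ := by
  have hA : ∀ x : Fin d → ℝ, ∑ i, (∑ j, A i j * x j) ^ 2 ≤ matOpNorm A ^ 2 * ∑ i, x i ^ 2 := by
    intro x
    have h := (LinearMap.toContinuousLinearMap (Matrix.toEuclideanLin A)).le_opNorm
      (WithLp.toLp 2 x)
    have h2 := pow_le_pow_left₀ (norm_nonneg _) h 2
    rw [mul_pow, EuclideanSpace.norm_sq_eq, EuclideanSpace.norm_sq_eq] at h2
    simpa [matOpNorm, Matrix.mulVec, dotProduct, Matrix.toLpLin_apply] using h2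
  have hn : ∀ z : ℂ, ‖z‖ ^ 2 = z.re ^ 2 + z.im ^ 2 := fun z => by
    rw [Complex.sq_norm, Complex.normSq_apply]; ring
  refine le_of_sq_le_sq ?_ (mul_nonneg (norm_nonneg _) (norm_nonneg _))
  rw [mul_pow, EuclideanSpace.norm_sq_eq, EuclideanSpace.norm_sq_eq]
  simp only [hn, Finset.sum_add_distrib, Complex.re_sum, Complex.im_sum, Complex.re_ofReal_mul,
    Complex.im_ofReal_mul, mul_add]
  exact add_le_add (hA fun i => (b i).re) (hA fun i => (b i).im)

theorem re_inner_le_of_eq_sum {d : ℕ} (A : Matrix (Fin d) (Fin d) ℝ) (P : Finset (Fin d)) (k : ℝ)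
    {a V : EuclideanSpace ℂ (Fin d)} {h : Fin d → Fin d → ℂ}
    (hV : ∀ i, V i = ∑ j ∈ P, ((A i j : ℂ) * (Complex.I * k * a j) + h i j)) :
    (inner ℂ a V).re ≤ matOpNorm A * (|k| * ‖a‖ ^ 2) +
      ∑ p ∈ Finset.univ ×ˢ P, ‖a‖ * ‖h p.1 p.2‖ := by
  set b : EuclideanSpace ℂ (Fin d) :=
    WithLp.toLp 2 fun j => if j ∈ P then Complex.I * k * a j else 0 with hb
  set V₁ : EuclideanSpace ℂ (Fin d) := WithLp.toLp 2 fun i => ∑ j, (A i j : ℂ) * b j with hV₁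
  have hsplit : V = V₁ + WithLp.toLp 2 fun i => ∑ j ∈ P, h i j := by
    ext i
    simp [hV, hV₁, hb, Finset.sum_add_distrib, mul_ite, Finset.sum_ite_mem]
  have hbn : ‖b‖ ≤ |k| * ‖a‖ := by
    refine le_of_sq_le_sq ?_ (by positivity)
    rw [mul_pow, EuclideanSpace.norm_sq_eq, EuclideanSpace.norm_sq_eq, Finset.mul_sum]
    refine Finset.sum_le_sum fun j _ => ?_
    rw [hb]
    dsimp only
    split_ifs
    · simp [mul_pow]
    · simp; positivity
  rw [hsplit, inner_add_right, Complex.add_re]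
  refine add_le_add ?_ ?_
  · calc _ ≤ ‖a‖ * ‖V₁‖ := (Complex.re_le_norm _).trans (norm_inner_le_norm _ _)
      _ ≤ ‖a‖ * (matOpNorm A * (|k| * ‖a‖)) := by
        have := norm_toLp_map_mulVec_le A b
        have h0 : 0 ≤ matOpNorm A := norm_nonneg _
        gcongr
        exact this.trans (by gcongr)
      _ = _ := by ring
  · refine (Complex.re_le_norm _).trans ?_
    rw [PiLp.inner_apply, Finset.sum_product]
    refine (norm_sum_le _ _).trans (Finset.sum_le_sum fun i _ => ?_)
    refine (norm_inner_le_norm _ _).trans ?_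
    rw [← Finset.mul_sum]
    exact mul_le_mul (PiLp.norm_apply_le a i) (norm_sum_le _ _) (norm_nonneg _) (norm_nonneg _)

theorem GevreyBound.I_mul {s σ B : ℝ} {h : ℝ → ℂ} (hh : GevreyBound s σ h B) :
    GevreyBound (s - 1) σ (fun k => Complex.I * k * h k) B := by
  have hm : AEStronglyMeasurable (fun k : ℝ => (sqrtWeight (s - 1) σ k : ℂ) *
      (Complex.I * k * h k)) volume :=
    (Complex.continuous_ofReal.comp (continuous_sqrtWeight _ σ)).aestronglyMeasurable.mul
      ((Continuous.aestronglyMeasurable (by fun_prop)).mul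
        (aestronglyMeasurable_of_sqrtWeight_mul hh.1.1))
  have hle : ∀ k : ℝ, ‖(sqrtWeight (s - 1) σ k : ℂ) * (Complex.I * k * h k)‖ ≤
      ‖(sqrtWeight s σ k : ℂ) * h k‖ := by
    intro k
    have h1 : sqrtWeight s σ k = sqrtWeight (s - 1) σ k * Real.sqrt (1 + k ^ 2) := by
      unfold sqrtWeight
      rw [Real.sqrt_eq_rpow, mul_assoc, ← Real.rpow_add (by positivity)]
      ring_nf
    have h2 := sqrtWeight_pos (s - 1) σ k
    simp only [norm_mul, Complex.norm_real, Complex.norm_I, one_mul, Real.norm_eq_abs]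
    rw [h1, abs_mul, mul_assoc, abs_of_nonneg (Real.sqrt_nonneg _)]
    gcongr
    exact Real.abs_le_sqrt (by linarith)
  exact ⟨hh.1.mono hm (Filter.Eventually.of_forall hle),
    (eLpNorm_mono hle).trans hh.2⟩

theorem fourierSynth_sum {ι : Type*} (P : Finset ι) {f : ι → ℝ → ℂ}
    (hf : ∀ i ∈ P, Integrable (f i)) (x : ℝ) :
    fourierSynth (fun k => ∑ i ∈ P, f i k) x = ∑ i ∈ P, fourierSynth (f i) x := by
  unfold fourierSynth
  simp only [Finset.mul_sum]
  rw [integral_finsetSum _ fun i hi => integrable_cexp_mul (hf i hi) x, Finset.mul_sum]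

theorem fourierSynth_const_mul_add {f g : ℝ → ℂ} (c : ℂ) (hf : Integrable f) (hg : Integrable g)
    (x : ℝ) :
    fourierSynth (fun k => c * f k + g k) x = c * fourierSynth f x + fourierSynth g x := by
  have h1 := integral_add ((integrable_cexp_mul hf x).const_mul c) (integrable_cexp_mul hg x)
  rw [integral_const_mul] at h1
  unfold fourierSynth
  rw [mul_left_comm, ← mul_add, ← h1]
  congr 1
  exact integral_congr_ae (Filter.Eventually.of_forall fun k => by dsimp only; ring)

theorem exists_finset_fourierSynth_eq {d : ℕ} {s σ : ℝ} (hs : 3 / 2 < s) (hσ : 0 < σ)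
    {f : Fin d → Fin d → (Fin d → ℂ) → ℂ} (hf : ∀ i j z, AnalyticAt ℂ (f i j) z)
    {u v : ℝ → EuclideanSpace ℂ (Fin d)} (hu : MemGevrey s σ u) (hv : MemGevrey s σ v)
    (h : ∀ᵐ x : ℝ, ∀ i, v x i = ∑ j, f i j (u x).ofLp * deriv (fun y => u y j) x) :
    ∃ P : Finset (Fin d), ∀ i x, fourierSynth (fun k => fHat v k i) x =
      ∑ j ∈ P, f i j (fun l => fourierSynth (fun k => fHat u k l) x) *
        fourierSynth (fun k => Complex.I * k * fHat u k j) x := by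
  have hs' : 1 / 2 < s := by linarith
  have han : ∀ {s : ℝ} {g : ℝ → ℂ} {B : ℝ}, 1 / 2 < s → GevreyBound s σ g B → ∀ x,
      AnalyticAt ℝ (fourierSynth g) x := fun hs hg x =>
    analyticAt_fourierSynth hσ (aestronglyMeasurable_of_sqrtWeight_mul hg.1.1)
      (integrable_exp_mul_of_memLp hs hg.1) x
  have hder : ∀ j x, HasDerivAt (fourierSynth fun k => fHat u k j)
      (fourierSynth (fun k => Complex.I * k * fHat u k j) x) x := fun j x =>
    hasDerivAt_fourierSynth hσ
      (aestronglyMeasurable_of_sqrtWeight_mul (hu.gevreyBound_apply j).1.1)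
      (integrable_exp_mul_of_memLp hs' (hu.gevreyBound_apply j).1) x
  refine exists_forall_eq_of_ae_exists (fun i => han hs' (hv.gevreyBound_apply i)) ?_ ?_
  · intro P i x
    refine Finset.analyticAt_fun_sum _ fun j _ => AnalyticAt.mul ?_
      (han (by linarith) (hu.gevreyBound_apply j).I_mul x)
    exact (hf i j _).restrictScalars.fun_comp (AnalyticAt.pi fun l =>
      han hs' (hu.gevreyBound_apply l) x)
  · have hua := fun i => hu.fourierSynth_ae_eq hs' hσ.le i
    have hva := fun i => hv.fourierSynth_ae_eq hs' hσ.le i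
    filter_upwards [h, ae_all_iff.2 hua, ae_all_iff.2 hva] with x hx hux hvx
    classical
    refine ⟨Finset.univ.filter fun j => deriv (fun y => u y j) x ≠ 0, fun i => ?_⟩
    rw [hvx i, hx i, Finset.sum_filter]
    refine Finset.sum_congr rfl fun j _ => ?_
    have hl : (fun l => fourierSynth (fun k => fHat u k l) x) = (u x).ofLp := funext hux
    rw [hl]
    split_ifs with hj
    · rw [(deriv_eq_zero_or_of_ae_eq (hua j).symm (hder j x)).resolve_left hj]
    · rw [not_not.1 hj, mul_zero]

theorem exists_gevreyBound_remainder {d : ℕ} {s σ B : ℝ} (hs : 1 / 2 < s) (hσ : 0 ≤ σ)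
    {f : Fin d → Fin d → (Fin d → ℂ) → ℂ} {u v : ℝ → EuclideanSpace ℂ (Fin d)}
    (hv : ∀ i, Integrable fun k => fHat v k i)
    (hw : ∀ j, GevreyBound s σ (fun k => Complex.I * k * fHat u k j) B) (hB : 0 ≤ B)
    {P : Finset (Fin d)}
    (h : ∀ i x, fourierSynth (fun k => fHat v k i) x =
      ∑ j ∈ P, f i j (fun l => fourierSynth (fun k => fHat u k l) x) *
        fourierSynth (fun k => Complex.I * k * fHat u k j) x)
    {C : Fin d → Fin d → ℝ}
    (hf : ∀ i j, IsMultiplier s σ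
      (fun x => f i j (fun l => fourierSynth (fun k => fHat u k l) x) - f i j 0) (C i j)) :
    ∃ r : Fin d → Fin d → ℝ → ℂ, (∀ i j, GevreyBound s σ (r i j) (C i j * B)) ∧
      ∀ᵐ k : ℝ, ∀ i, fHat v k i =
        ∑ j ∈ P, (f i j 0 * (Complex.I * k * fHat u k j) + r i j k) := by
  choose r hr hrs using fun i j => hf i j _ B hB (hw j)
  refine ⟨r, hr, ae_all_iff.2 fun i => ?_⟩
  have hwi := fun j => integrable_of_memLp_sqrtWeight_mul hs hσ (hw j).1
  have hri := fun j => integrable_of_memLp_sqrtWeight_mul hs hσ (hr i j).1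
  have hsi : ∀ j ∈ P, Integrable fun k : ℝ =>
      f i j 0 * (Complex.I * k * fHat u k j) + r i j k := fun j _ =>
    ((hwi j).const_mul _).add (hri j)
  refine ae_eq_of_fourierSynth_eq (hv i) (integrable_finsetSum _ hsi) fun x => ?_
  rw [fourierSynth_sum P hsi, h i x]
  refine Finset.sum_congr rfl fun j _ => ?_
  rw [fourierSynth_const_mul_add _ (hwi j) (hri j), hrs]
  ring

theorem gevreyNorm_sq {E : Type*} [NormedAddCommGroup E] [NormedSpace ℂ E] (s σ : ℝ) (u : ℝ → E) :
    gevreyNorm s σ u ^ 2 = ∫ k, gevreyWeight s σ k * ‖fHat u k‖ ^ 2 :=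
  Real.sq_sqrt (integral_nonneg fun k => mul_nonneg (gevreyWeight_pos s σ k).le (sq_nonneg _))

/-- A priori energy estimate in a time-dependent scale of Gevrey spaces:
for every solution `u ∈ C¹([0,T*], G^{m+2}_{σ₀})` of `∂_T u = M(u)∂_X u` with entire `M`,
the energy `E(T) = ‖u(T)‖²_{G^m_{σ(T)}}`, `σ(T) = σ₀ - ηT`, is differentiable and satisfies
`(1/2)E'(T) + (η - ‖M(0)‖ - φₘ(‖u(T)‖_{G^m_{σ(T)}}))‖u(T)‖²_{G^{m+1/2}_{σ(T)}} ≤ 0`. -/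
theorem gevrey_apriori_estimate (d : ℕ) (m : ℝ) (hm : 1 < m)
    (M : (Fin d → ℝ) → Matrix (Fin d) (Fin d) ℝ)
    (hM : ∃ MC : ((Fin d) → ℂ) → Matrix (Fin d) (Fin d) ℂ,
      (∀ i j : Fin d, ∀ z : (Fin d) → ℂ, AnalyticAt ℂ (fun w => MC w i j) z) ∧
      ∀ (x : Fin d → ℝ) (i j : Fin d), MC (fun l => (x l : ℂ)) i j = (M x i j : ℂ)) :
    ∃ φm : ℂ → ℂ,
      (∀ z : ℂ, AnalyticAt ℂ φm z) ∧
      (∀ x : ℝ, 0 ≤ x → (φm x).im = 0) ∧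
      MonotoneOn (fun x : ℝ => (φm x).re) (Set.Ici 0) ∧
      φm 0 = 0 ∧
      ∀ σ₀ η Tstar : ℝ, 0 < σ₀ → 0 < η → 0 < Tstar → 0 ≤ σ₀ - η * Tstar →
      ∀ u : ℝ → ℝ → Fin d → ℂ,
        (∀ (T : ℝ) (X : ℝ) (i : Fin d), (u T X i).im = 0) →
        GevreyC1On (m + 2) σ₀ (fun T => vecE (u T)) (Set.Icc 0 Tstar) →
        GevreyContOn (m + 2) σ₀ (fun T => vecE (u T)) (Set.Icc 0 Tstar) →
        (∀ T ∈ Set.Icc (0:ℝ) Tstar, ∀ (X : ℝ) (i : Fin d),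
          HasDerivAt (fun S => u S X i)
            (∑ j : Fin d, (M (fun l => (u T X l).re) i j : ℂ) * deriv (fun Y => u T Y j) X)
            T) →
        ∀ T ∈ Set.Ioc (0:ℝ) Tstar,
          ∃ E' : ℝ,
            HasDerivWithinAt
              (fun S => (gevreyNorm m (σ₀ - η * S) (vecE (u S))) ^ 2)
              E' (Set.Ioc 0 Tstar) T ∧
            (1 / 2) * E' +
              (η - matOpNorm (M 0) -
                (φm ((gevreyNorm m (σ₀ - η * T) (vecE (u T)) : ℝ) : ℂ)).re) *
              (gevreyNorm (m + 1 / 2) (σ₀ - η * T) (vecE (u T))) ^ 2 ≤ 0 := by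
  obtain ⟨MC, hMC, hMC'⟩ := hM
  choose φ hφ hφ0 hφm hφi hφb using fun i j =>
    exists_entire_multiplier_bound (s := m - 1 / 2) (by linarith) (hMC i j)
  have hφnn : ∀ i j x, 0 ≤ x → 0 ≤ (φ i j (x : ℝ)).re := fun i j x hx => by
    have := hφm i j Set.self_mem_Ici hx hx
    simpa [hφ0] using this
  refine ⟨fun z => ∑ p : Fin d × Fin d, φ p.1 p.2 z, fun z => ?_, fun x _ => ?_, ?_, ?_, ?_⟩
  · exact Finset.analyticAt_fun_sum _ fun p _ => hφ p.1 p.2 z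
  · simp [Complex.im_sum, hφi]
  · intro x hx y hy hxy
    simp only [Complex.re_sum]
    exact Finset.sum_le_sum fun p _ => hφm p.1 p.2 hx hy hxy
  · simp [hφ0]
  intro σ₀ η Tstar hσ₀ hη hTs hσT u hureal hC1 hu hsol T hT
  obtain ⟨v, hlim, hv⟩ := hC1
  have hTI : T ∈ Set.Icc 0 Tstar := ⟨hT.1.le, hT.2⟩
  have hsub : Set.Ioc 0 Tstar ⊆ Set.Icc 0 Tstar := Set.Ioc_subset_Icc_self
  have hσ : 0 ≤ σ₀ - η * T := by nlinarith [hT.2]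
  have hσle : σ₀ - η * T ≤ σ₀ := by nlinarith [hT.1]
  have huT := hu.1 T hTI
  have hvT := hv.1 T hTI
  have hne : (nhdsWithin T (Set.Icc 0 Tstar \ {T})).NeBot :=
    (right_nhdsWithin_Ioo_neBot hT.1).mono (nhdsWithin_mono T fun x hx =>
      ⟨⟨hx.1.le, hx.2.le.trans hT.2⟩, hx.2.ne⟩)
  have hvae := ae_eq_of_tendsto_gevreyNorm_slope (s := m + 2) (by linarith) hσ₀.le hTI hu.1 hvT
    (hlim T hTI) (fun x i => hsol T hTI x i)
  obtain ⟨P, hP⟩ := exists_finset_fourierSynth_eq (s := m + 2) (by linarith) hσ₀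
    (f := fun i j w => MC w i j) hMC huT hvT (by
      filter_upwards [hvae] with x hx i
      rw [hx i]
      refine Finset.sum_congr rfl fun j _ => ?_
      rw [← hMC']
      congr 3
      funext l
      exact Complex.ext rfl (hureal T x l).symm)
  have hmem : ∀ {s' : ℝ}, s' ≤ m + 2 → MemGevrey s' (σ₀ - η * T) (vecE (u T)) := fun hs =>
    huT.of_le (gevreyWeight_le_gevreyWeight hs hσle)
  have hvmem : MemGevrey m (σ₀ - η * T) (v T) :=
    hvT.of_le (gevreyWeight_le_gevreyWeight (by linarith) hσle)
  set B := gevreyNorm m (σ₀ - η * T) (vecE (u T)) with hB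
  have hB0 : 0 ≤ B := Real.sqrt_nonneg _
  have hw : ∀ j, GevreyBound (m - 1 / 2) (σ₀ - η * T)
      (fun k => Complex.I * k * fHat (vecE (u T)) k j)
      (gevreyNorm (m + 1 / 2) (σ₀ - η * T) (vecE (u T))) := fun j => by
    have := ((hmem (s' := m + 1 / 2) (by linarith)).gevreyBound_apply j).I_mul
    rwa [show m + 1 / 2 - 1 = m - 1 / 2 by ring] at this
  have ha : ∀ l, GevreyBound (m - 1 / 2) (σ₀ - η * T) (fun k => fHat (vecE (u T)) k l) B :=
    fun l => gevreyBound_of_integrable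
      (aestronglyMeasurable_of_sqrtWeight_mul (huT.gevreyBound_apply l).1.1)
      (hmem (by linarith)).2 fun k => mul_le_mul
        (gevreyWeight_le_gevreyWeight (by linarith) le_rfl k)
        (pow_le_pow_left₀ (norm_nonneg _) (PiLp.norm_apply_le _ l) 2) (sq_nonneg _)
        (gevreyWeight_pos _ _ k).le
  obtain ⟨r, hr, hre⟩ := exists_gevreyBound_remainder (s := m - 1 / 2)
    (f := fun i j w => MC w i j) (C := fun i j => (φ i j B).re) (by linarith) hσ
    (hvmem.integrable_fHat_apply (by linarith) hσ) hw (Real.sqrt_nonneg _) hP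
    (fun i j => hφb i j _ hσ _ B hB0 ha)
  have hM0 : ∀ i j, MC 0 i j = (M 0 i j : ℂ) := fun i j => by
    rw [← hMC']
    congr
  have hq : ∀ S ∈ Set.Icc 0 Tstar, ∀ k,
      fHat (fun x => (S - T)⁻¹ • (vecE (u S) x - vecE (u T) x) - v T x) k =
        (S - T)⁻¹ • (fHat (vecE (u S)) k - fHat (vecE (u T)) k) - fHat (v T) k := by
    intro S hS k
    rw [fHat_sub (((hu.1 S hS).sub huT).smul _).1 hvT.1, fHat_smul,
      fHat_sub (hu.1 S hS).1 huT.1]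
  have hderiv := hasDerivWithinAt_gevrey_energy (s := m) (σ₀ := σ₀) (I := Set.Ioc 0 Tstar)
    (a := fun S => fHat (vecE (u S))) (V := fHat (v T)) hη.le hT.1 (fun S hS => hS.1.le) hT
    (fun S hS => (hu.1 S (hsub hS)).aestronglyMeasurable) hvT.aestronglyMeasurable
    (fun S hS => (hu.1 S (hsub hS)).2) hvT.2
    (fun S hS => by
      have := ((((hu.1 S (hsub hS)).sub huT).smul (S - T)⁻¹).sub hvT).2
      simpa only [hq S (hsub hS)] using this)
    (by
      have h2 := ((hlim T hTI).pow 2).mono_left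
        (nhdsWithin_mono T (Set.sdiff_subset_sdiff_left hsub))
      rw [zero_pow two_ne_zero] at h2
      refine h2.congr' ?_
      filter_upwards [self_mem_nhdsWithin] with S hS
      rw [gevreyNorm_sq]
      simp only [hq S (hsub hS.1)])
  refine ⟨_, hderiv.congr (fun S _ => gevreyNorm_sq _ _ _) (gevreyNorm_sq _ _ _), ?_⟩
  have hfin := integral_energy_le (s := m) (σ := σ₀ - η * T) (η := η) (μ := matOpNorm (M 0))
    hη.le (norm_nonneg _) huT.aestronglyMeasurable hvT.aestronglyMeasurable
    (hmem (by linarith)).2 hvmem.2 (P := Finset.univ ×ˢ P) (h := fun p => r p.1 p.2)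
    (C := fun p => (φ p.1 p.2 B).re) (fun p _ => hφnn _ _ _ hB0)
    (fun p _ => hr p.1 p.2) (by
      filter_upwards [hre] with k hk
      exact re_inner_le_of_eq_sum (M 0) P k (h := fun i j => r i j k)
        (by simpa only [hM0] using hk))
  rw [← gevreyNorm_sq] at hfin
  have hsum : ∑ p ∈ Finset.univ ×ˢ P, (φ p.1 p.2 B).re ≤
      (∑ p : Fin d × Fin d, φ p.1 p.2 (B : ℂ)).re := by
    rw [Complex.re_sum]
    exact Finset.sum_le_sum_of_subset_of_nonneg (Finset.subset_univ _)
      fun p _ _ => hφnn _ _ _ hB0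
  have := mul_le_mul_of_nonneg_right hsum
    (sq_nonneg (gevreyNorm (m + 1 / 2) (σ₀ - η * T) (vecE (u T))))
  linarith
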